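/- Let m > n ≥ 1, let A be a real m×n matrix of rank n, let b ∈ ℝ^m and let c ∈ ℝ^n be nonzero. For each sign vector ε ∈ {−1,1}^m, let I_ε ⊆ (0,∞) be an interval and let c_ε = (x_ε, s_ε, y_ε) : I_ε → ℝ^n × ℝ^m × ℝ^m be a C² curve such that for every μ ∈ I_ε: A x_ε(μ) − s_ε(μ) = b, Aᵀ y_ε(μ) = c, (s_ε(μ))_i (y_ε(μ))_i = μ for all i, ε_i (s_ε(μ))_i > 0 for all i, and the derivative ċ_ε(μ) is nonzero. Then the sum over all 2^m sign vectors ε of the total curvature of c_ε, i.e. Σ_ε ∫_{I_ε} ‖(d/dμ)(ċ_ε(μ)/‖ċ_ε(μ)‖)‖ dμ, is at most 2π·n·C(m−1,n), where C(m−1,n) is the binomial coefficient. -/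

import Mathlib

open MeasureTheory

section CPparts

open Filter Topology
open scoped Matrix

section

namespace CP

variable {m n : ℕ}

/-- slack -/
def sl (A : Fin m → Fin n → ℝ) (b : Fin m → ℝ) (x : Fin n → ℝ) (i : Fin m) : ℝ :=
  ∑ j, A i j * x j - b i

/-- sign -/
def sg (σ : Fin m → Bool) (i : Fin m) : ℝ := if σ i then 1 else -1

lemma sg_mul_self (σ : Fin m → Bool) (i : Fin m) : sg σ i * sg σ i = 1 := by
  unfold sg; split_ifs <;> norm_num

structure IsSol (A : Fin m → Fin n → ℝ) (b : Fin m → ℝ) (c : Fin n → ℝ) (μ : ℝ)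
    (x : Fin n → ℝ) (y : Fin m → ℝ) : Prop where
  dual : ∀ j, ∑ i, A i j * y i = c j
  comp : ∀ i, sl A b x i * y i = μ

structure SolS (σ : Fin m → Bool) (A : Fin m → Fin n → ℝ) (b : Fin m → ℝ) (c : Fin n → ℝ) (μ : ℝ)
    (x : Fin n → ℝ) (y : Fin m → ℝ) : Prop extends IsSol A b c μ x y where
  sgn : ∀ i, 0 < sg σ i * sl A b x i

abbrev Par (m n : ℕ) := (Fin m → Fin n → ℝ) × (Fin m → ℝ) × (Fin n → ℝ) × ℝ

def FF (p : Par m n × ((Fin n → ℝ) × (Fin m → ℝ))) : (Fin m → ℝ) × (Fin n → ℝ) :=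
  (fun i => (∑ j, p.1.1 i j * p.2.1 j - p.1.2.1 i) * p.2.2 i - p.1.2.2.2,
   fun j => ∑ i, p.1.1 i j * p.2.2 i - p.1.2.2.1 j)

lemma FF_contDiff : ContDiff ℝ 1 (FF (m := m) (n := n)) := by
  unfold FF
  fun_prop

lemma FF_eq_zero (q : Par m n) (x : Fin n → ℝ) (y : Fin m → ℝ) :
    FF (q, (x, y)) = 0 ↔ IsSol q.1 q.2.1 q.2.2.1 q.2.2.2 x y := by
  constructor
  · intro h
    have h1 := congrArg Prod.fst h
    have h2 := congrArg Prod.snd h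
    refine ⟨fun j => ?_, fun i => ?_⟩
    · have := congrFun h2 j; simp [FF] at this; linarith
    · have := congrFun h1 i; simp [FF] at this; unfold sl; linarith
  · rintro ⟨h1, h2⟩
    refine Prod.ext (funext fun i => ?_) (funext fun j => ?_)
    · have := h2 i; unfold sl at this; simp [FF]; linarith
    · have := h1 j; simp [FF]; linarith

/-- linearization is injective -/
def Nondeg (A : Fin m → Fin n → ℝ) (b : Fin m → ℝ) (x : Fin n → ℝ) (y : Fin m → ℝ) : Prop :=
  ∀ (u : Fin n → ℝ) (z : Fin m → ℝ),
    (∀ i, (∑ j, A i j * u j) * y i + sl A b x i * z i = 0) →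
    (∀ j, ∑ i, A i j * z i = 0) → u = 0 ∧ z = 0

lemma FF_deriv (q : Par m n) (x u : Fin n → ℝ) (y z : Fin m → ℝ) :
    fderiv ℝ FF (q, (x, y)) (0, (u, z)) =
      (fun i => (∑ j, q.1 i j * u j) * y i + sl q.1 q.2.1 x i * z i,
       fun j => ∑ i, q.1 i j * z i) := by
  have hF : HasFDerivAt FF (fderiv ℝ FF (q, (x, y))) (q, (x, y)) :=
    (FF_contDiff.differentiable one_ne_zero _).hasFDerivAt
  have hl : HasDerivAt (fun t : ℝ => ((q, (x + t • u, y + t • z)) : Par m n × ((Fin n → ℝ) × (Fin m → ℝ))))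
      (0, (u, z)) 0 := by
    refine (hasDerivAt_const _ _).prodMk (HasDerivAt.prodMk ?_ ?_)
    · simpa using ((hasDerivAt_id (0:ℝ)).smul_const u).const_add x
    · simpa using ((hasDerivAt_id (0:ℝ)).smul_const z).const_add y
  have h1 := HasFDerivAt.comp_hasDerivAt_of_eq (x := (0:ℝ)) (hl := hF) (hf := hl) (by simp)
  refine h1.unique ?_
  refine HasDerivAt.prodMk ?_ ?_
  · rw [hasDerivAt_pi]
    intro i
    simp only [Function.comp, Pi.add_apply, Pi.smul_apply, smul_eq_mul]
    have ha : HasDerivAt (fun t : ℝ => ∑ j, q.1 i j * (x j + t * u j) - q.2.1 i) (∑ j, q.1 i j * u j) 0 := by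
      refine HasDerivAt.sub_const _ (HasDerivAt.fun_sum fun j _ => ?_)
      simpa using (((hasDerivAt_id (0:ℝ)).mul_const (u j)).const_add (x j)).const_mul (q.1 i j)
    have hb : HasDerivAt (fun t : ℝ => y i + t * z i) (z i) 0 := by
      simpa using ((hasDerivAt_id (0:ℝ)).mul_const (z i)).const_add (y i)
    have := (ha.mul hb).sub_const q.2.2.2
    simpa [sl] using this
  · rw [hasDerivAt_pi]
    intro j
    simp only [Function.comp, Pi.add_apply, Pi.smul_apply, smul_eq_mul]
    refine HasDerivAt.sub_const _ (HasDerivAt.fun_sum fun i _ => ?_)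
    simpa using (((hasDerivAt_id (0:ℝ)).mul_const (z i)).const_add (y i)).const_mul (q.1 i j)

theorem ift (q : Par m n) (x : Fin n → ℝ) (y : Fin m → ℝ)
    (hs : IsSol q.1 q.2.1 q.2.2.1 q.2.2.2 x y) (hnd : Nondeg q.1 q.2.1 x y) :
    ∃ φ : Par m n → (Fin n → ℝ) × (Fin m → ℝ), Tendsto φ (𝓝 q) (𝓝 (x, y)) ∧
      ∀ᶠ q' in 𝓝 q, IsSol q'.1 q'.2.1 q'.2.2.1 q'.2.2.2 (φ q').1 (φ q').2 := by
  have hF : HasStrictFDerivAt FF (fderiv ℝ FF (q, (x, y))) (q, (x, y)) :=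
    FF_contDiff.contDiffAt.hasStrictFDerivAt one_ne_zero
  have hinv : (fderiv ℝ FF (q, (x, y)) ∘L .inr ℝ (Par m n) ((Fin n → ℝ) × (Fin m → ℝ))).IsInvertible := by
    set T := fderiv ℝ FF (q, (x, y)) ∘L .inr ℝ (Par m n) ((Fin n → ℝ) × (Fin m → ℝ)) with hT
    have hinj : Function.Injective T.toLinearMap := by
      rw [← LinearMap.ker_eq_bot, LinearMap.ker_eq_bot']
      rintro ⟨u, z⟩ h
      have h' : fderiv ℝ FF (q, (x, y)) (0, (u, z)) = 0 := by simpa [hT] using h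
      rw [FF_deriv] at h'
      have h1 := congrArg Prod.fst h'
      have h2 := congrArg Prod.snd h'
      obtain ⟨rfl, rfl⟩ := hnd u z (fun i => congrFun h1 i) (fun j => congrFun h2 j)
      rfl
    let e := LinearEquiv.ofInjectiveOfFinrankEq T.toLinearMap hinj (by simp [add_comm])
    refine ⟨e.toContinuousLinearEquiv, ?_⟩
    ext v <;> rfl
  refine ⟨hF.implicitFunctionOfProdDomain hinv, hF.tendsto_implicitFunctionOfProdDomain hinv, ?_⟩
  filter_upwards [hF.eventually_apply_implicitFunctionOfProdDomain hinv] with q' hq'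
  rw [← FF_eq_zero]
  rw [(FF_eq_zero q x y).2 hs] at hq'
  exact hq'

lemma SolS.s_ne {σ : Fin m → Bool} {A : Fin m → Fin n → ℝ} {b c μ x y} (h : SolS σ A b c μ x y) (i) :
    sl A b x i ≠ 0 := by
  intro h0; have := h.sgn i; simp [h0] at this

lemma SolS.sgy {σ : Fin m → Bool} {A : Fin m → Fin n → ℝ} {b c μ x y} (h : SolS σ A b c μ x y)
    (hμ : 0 < μ) (i) : 0 < sg σ i * y i := by
  have h1 := h.sgn i
  have h2 := h.comp i
  have h3 : (sg σ i * sl A b x i) * (sg σ i * y i) = μ := by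
    rw [← h2]; linear_combination (sl A b x i * y i) * sg_mul_self σ i
  by_contra hn
  push Not at hn
  nlinarith

/-- orthogonality -/
lemma orth {A : Fin m → Fin n → ℝ} {c : Fin n → ℝ} {y y' : Fin m → ℝ} (b x x')
    (h : ∀ j, ∑ i, A i j * y i = c j) (h' : ∀ j, ∑ i, A i j * y' i = c j) :
    ∑ i, (sl A b x i - sl A b x' i) * (y i - y' i) = 0 := by
  have : ∀ i, (sl A b x i - sl A b x' i) * (y i - y' i) =
      ∑ j, (x j - x' j) * (A i j * y i - A i j * y' i) := by
    intro i
    have : sl A b x i - sl A b x' i = ∑ j, A i j * (x j - x' j) := by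
      unfold sl
      rw [sub_sub_sub_cancel_right, ← Finset.sum_sub_distrib]
      exact Finset.sum_congr rfl fun j _ => by ring
    rw [this, Finset.sum_mul]
    exact Finset.sum_congr rfl fun j _ => by ring
  simp_rw [this]
  rw [Finset.sum_comm]
  refine Finset.sum_eq_zero fun j _ => ?_
  rw [← Finset.mul_sum, Finset.sum_sub_distrib, h, h', sub_self, mul_zero]

/-- full column rank -/
def Inj (A : Fin m → Fin n → ℝ) : Prop := ∀ u : Fin n → ℝ, (∀ i, ∑ j, A i j * u j = 0) → u = 0

lemma SolS.nondeg {σ : Fin m → Bool} {A : Fin m → Fin n → ℝ} {b c μ x y} (h : SolS σ A b c μ x y)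
    (hA : Inj A) (hμ : 0 < μ) : Nondeg A b x y := by
  intro u z h1 h2
  have hyne : ∀ i, y i ≠ 0 := fun i h0 => by have := h.sgy hμ i; simp [h0] at this
  have h3 : ∑ i, (∑ j, A i j * u j) * z i = 0 := by
    simp_rw [Finset.sum_mul]
    rw [Finset.sum_comm]
    refine Finset.sum_eq_zero fun j _ => ?_
    have := h2 j
    calc ∑ i, A i j * u j * z i = u j * ∑ i, A i j * z i := by
          rw [Finset.mul_sum]; exact Finset.sum_congr rfl fun i _ => by ring
      _ = 0 := by rw [this, mul_zero]
  have h4 : ∀ i, (∑ j, A i j * u j) * z i = - (μ⁻¹ * (sl A b x i * z i)^2) := by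
    intro i
    have h5 := h1 i
    have h6 := h.comp i
    have : (∑ j, A i j * u j) * y i = - (sl A b x i * z i) := by linarith
    field_simp
    rw [← h6]
    linear_combination (sl A b x i * z i) * this
  simp_rw [h4] at h3
  rw [Finset.sum_neg_distrib, neg_eq_zero, Finset.sum_eq_zero_iff_of_nonneg (fun i _ => by positivity)] at h3
  have hz : ∀ i, z i = 0 := fun i => by
    have := h3 i (Finset.mem_univ _)
    have hs := h.s_ne i
    have : (sl A b x i * z i)^2 = 0 := by
      rcases mul_eq_zero.1 this with h | h
      · exact absurd h (by positivity)
      · exact h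
    have := pow_eq_zero_iff (two_ne_zero) |>.1 this
    exact (mul_eq_zero.1 this).resolve_left hs
  refine ⟨hA u fun i => ?_, funext hz⟩
  have := h1 i
  rw [hz i, mul_zero, add_zero] at this
  exact (mul_eq_zero.1 this).resolve_right (hyne i)

lemma SolS.uniq {σ : Fin m → Bool} {A : Fin m → Fin n → ℝ} {b c μ x y x' y'} (h : SolS σ A b c μ x y)
    (h' : SolS σ A b c μ x' y') (hA : Inj A) (hμ : 0 < μ) : x = x' ∧ y = y' := by
  have h0 := orth b x x' h.dual h'.dual
  have hpos : ∀ i, 0 < sl A b x i * sl A b x' i := fun i => by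
    have := mul_pos (h.sgn i) (h'.sgn i)
    have e := sg_mul_self σ i
    have : sg σ i * sl A b x i * (sg σ i * sl A b x' i) = sl A b x i * sl A b x' i := by
      linear_combination (sl A b x i * sl A b x' i) * e
    linarith
  have h1 : ∀ i, (sl A b x i - sl A b x' i) * (y i - y' i) =
      - (μ * (sl A b x i - sl A b x' i)^2 / (sl A b x i * sl A b x' i)) := by
    intro i
    have a1 := h.s_ne i
    have a2 := h'.s_ne i
    have e1 : y i = μ / sl A b x i := by rw [eq_div_iff a1, mul_comm]; exact h.comp i
    have e2 : y' i = μ / sl A b x' i := by rw [eq_div_iff a2, mul_comm]; exact h'.comp i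
    rw [e1, e2]; field_simp; ring
  simp_rw [h1] at h0
  rw [Finset.sum_neg_distrib, neg_eq_zero, Finset.sum_eq_zero_iff_of_nonneg
    (fun i _ => by have := hpos i; positivity)] at h0
  have hs : ∀ i, sl A b x i = sl A b x' i := fun i => by
    have := h0 i (Finset.mem_univ _)
    have hp := hpos i
    rw [div_eq_zero_iff, or_iff_left hp.ne', mul_eq_zero, or_iff_right hμ.ne'] at this
    have := pow_eq_zero_iff (two_ne_zero) |>.1 this
    linarith
  constructor
  · have := hA (x - x') fun i => by
      have := hs i
      unfold sl at this
      simp only [Pi.sub_apply, mul_sub, Finset.sum_sub_distrib]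
      linarith
    exact sub_eq_zero.1 this
  · funext i
    have a := h.comp i
    rw [← h'.comp i, ← hs i] at a
    exact mul_left_cancel₀ (h.s_ne i) a

lemma tendsto_sl {α : Type*} {l : Filter α} {A : α → Fin m → Fin n → ℝ} {b : α → Fin m → ℝ}
    {x : α → Fin n → ℝ} {A0 b0 x0} (hA : Tendsto A l (𝓝 A0)) (hb : Tendsto b l (𝓝 b0))
    (hx : Tendsto x l (𝓝 x0)) (i : Fin m) :
    Tendsto (fun t => sl (A t) (b t) (x t) i) l (𝓝 (sl A0 b0 x0 i)) := by
  unfold sl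
  refine Tendsto.sub (tendsto_finsetSum _ fun j _ => Tendsto.mul ?_ ?_) ?_
  · exact ((tendsto_pi_nhds.1 ((tendsto_pi_nhds.1 hA) i)) j)
  · exact (tendsto_pi_nhds.1 hx) j
  · exact (tendsto_pi_nhds.1 hb) i

/-- local persistence of signed solutions -/
theorem SolS.persist {σ : Fin m → Bool} {q : Par m n} {x y}
    (h : SolS σ q.1 q.2.1 q.2.2.1 q.2.2.2 x y) (hA : Inj q.1) (hμ : 0 < q.2.2.2) :
    ∃ φ : Par m n → (Fin n → ℝ) × (Fin m → ℝ), Tendsto φ (𝓝 q) (𝓝 (x, y)) ∧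
      ∀ᶠ q' in 𝓝 q, SolS σ q'.1 q'.2.1 q'.2.2.1 q'.2.2.2 (φ q').1 (φ q').2 := by
  obtain ⟨φ, hφ, hs⟩ := ift q x y h.toIsSol (h.nondeg hA hμ)
  refine ⟨φ, hφ, ?_⟩
  have : ∀ᶠ q' in 𝓝 q, ∀ i, 0 < sg σ i * sl q'.1 q'.2.1 (φ q').1 i := by
    rw [eventually_all]
    intro i
    have ht : Tendsto (fun q' : Par m n => sg σ i * sl q'.1 q'.2.1 (φ q').1 i) (𝓝 q)
        (𝓝 (sg σ i * sl q.1 q.2.1 x i)) := by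
      refine (tendsto_sl (continuous_fst.tendsto q) ((continuous_fst.comp continuous_snd).tendsto q)
        ?_ i).const_mul _
      exact (continuous_fst.tendsto (x, y)).comp hφ
    exact ht.eventually_const_lt (h.sgn i)
  filter_upwards [hs, this] with q' h1 h2
  exact ⟨h1, h2⟩

end CP

end

section

namespace CP

variable {m n : ℕ}

lemma cross {A : Fin m → Fin n → ℝ} {b c μ x y μ' x' y'} (h : IsSol A b c μ x y)
    (h' : IsSol A b c μ' x' y') :
    ∑ i, (sl A b x i * y' i + sl A b x' i * y i) = m * (μ + μ') := by
  have h0 := orth b x x' h.dual h'.dual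
  have h1 : ∀ i, (sl A b x i - sl A b x' i) * (y i - y' i) =
      (μ + μ') - (sl A b x i * y' i + sl A b x' i * y i) := by
    intro i; rw [← h.comp i, ← h'.comp i]; ring
  simp_rw [h1] at h0
  rw [Finset.sum_sub_distrib] at h0
  simp at h0
  linarith

lemma sg_abs {σ : Fin m → Bool} {i : Fin m} {r : ℝ} (h : 0 ≤ sg σ i * r) : sg σ i * r = |r| := by
  unfold sg at *
  split_ifs at * with h1
  · rw [one_mul] at *; exact (abs_of_nonneg h).symm
  · rw [abs_of_nonpos (by linarith)]; ring

lemma sg_mul_mul {σ : Fin m → Bool} {i : Fin m} {r t : ℝ} (h : 0 ≤ sg σ i * r) (h' : 0 ≤ sg σ i * t) :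
    r * t = |r| * |t| := by
  rw [← sg_abs h, ← sg_abs h']
  linear_combination - (r * t) * sg_mul_self σ i

lemma exists_left (A : Fin m → Fin n → ℝ) (hA : Inj A) :
    ∃ R : Fin n → Fin m → ℝ, ∀ (x : Fin n → ℝ) (j), x j = ∑ i, R j i * ∑ k, A i k * x k := by
  let f : (Fin n → ℝ) →ₗ[ℝ] (Fin m → ℝ) := Matrix.mulVecLin (Matrix.of A)
  have hf : ∀ x i, f x i = ∑ k, A i k * x k := by
    intro x i; simp [f, Matrix.mulVec, dotProduct]
  obtain ⟨g, hg⟩ := f.exists_leftInverse_of_injective (by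
    rw [LinearMap.ker_eq_bot']
    intro u hu
    exact hA u fun i => by rw [← hf, hu]; rfl)
  refine ⟨fun j i => g (Pi.single i 1) j, fun x j => ?_⟩
  have h1 : g (f x) = x := by rw [← LinearMap.comp_apply, hg]; rfl
  conv_lhs => rw [← h1]
  have h2 : f x = ∑ i, (f x i) • (Pi.single i (1:ℝ)) := by
    exact (pi_eq_sum_univ' (f x)).trans (by
      refine Finset.sum_congr rfl fun i _ => ?_
      congr 1)
  rw [h2, map_sum, Finset.sum_apply]
  refine Finset.sum_congr rfl fun i _ => ?_
  rw [map_smul, ← hf]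
  simp [mul_comm]

lemma growth {σ : Fin m → Bool} {A : Fin m → Fin n → ℝ} {b c μ0 x0 y0} (hA : Inj A)
    (h0 : SolS σ A b c μ0 x0 y0) (hμ0 : 0 < μ0) :
    ∃ C : ℝ, 0 < C ∧ ∀ μ x y, 0 < μ → SolS σ A b c μ x y →
      (∀ i, |sl A b x i| ≤ C * (μ + 1)) ∧ (∀ i, |y i| ≤ C * (μ + 1)) ∧ (∀ j, |x j| ≤ C * (μ + 1)) := by
  obtain ⟨R, hR⟩ := exists_left A hA
  have hy0 : ∀ i, 0 < |y0 i| := fun i => by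
    rw [abs_pos]; intro h; have := h0.sgy hμ0 i; simp [h] at this
  have hs0 : ∀ i, 0 < |sl A b x0 i| := fun i => abs_pos.2 (h0.s_ne i)
  set C1 : ℝ := m * (1 + μ0) * ∑ i, (|y0 i|⁻¹ + |sl A b x0 i|⁻¹) with hC1
  have hC1n : 0 ≤ C1 := by positivity
  set C2 : ℝ := ∑ j, ∑ i, |R j i| * (C1 + |b i|) with hC2
  have hC2n : 0 ≤ C2 := by positivity
  refine ⟨C1 + C2 + 1, by positivity, fun μ x y hμ h => ?_⟩
  have hc := cross h.toIsSol h0.toIsSol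
  have e1 : ∀ i, sl A b x i * y0 i = |sl A b x i| * |y0 i| := fun i =>
    sg_mul_mul (h.sgn i).le (h0.sgy hμ0 i).le
  have e2 : ∀ i, sl A b x0 i * y i = |sl A b x0 i| * |y i| := fun i =>
    sg_mul_mul (h0.sgn i).le (h.sgy hμ i).le
  simp_rw [e1, e2] at hc
  have hi : ∀ i, |sl A b x i| * |y0 i| + |sl A b x0 i| * |y i| ≤ m * (μ + μ0) := fun i => by
    rw [← hc]
    exact Finset.single_le_sum (f := fun i => |sl A b x i| * |y0 i| + |sl A b x0 i| * |y i|)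
      (fun i _ => by positivity) (Finset.mem_univ i)
  have hmm : (m:ℝ) * (μ + μ0) ≤ m * (1 + μ0) * (μ + 1) := by
    have : (0:ℝ) ≤ m := by positivity
    nlinarith [mul_pos hμ hμ0, mul_nonneg this (mul_pos hμ hμ0).le]
  have hsum : ∀ i, |y0 i|⁻¹ + |sl A b x0 i|⁻¹ ≤ ∑ i, (|y0 i|⁻¹ + |sl A b x0 i|⁻¹) := fun i =>
    Finset.single_le_sum (f := fun i => |y0 i|⁻¹ + |sl A b x0 i|⁻¹)
      (fun i _ => by positivity) (Finset.mem_univ i)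
  have hs : ∀ i, |sl A b x i| ≤ C1 * (μ + 1) := fun i => by
    have a := hi i
    have b1 : |sl A b x i| * |y0 i| ≤ m * (1 + μ0) * (μ + 1) := by
      have : 0 ≤ |sl A b x0 i| * |y i| := by positivity
      linarith
    calc |sl A b x i| ≤ m * (1 + μ0) * (μ + 1) * |y0 i|⁻¹ := by
          rw [← div_eq_mul_inv, le_div_iff₀ (hy0 i)]; exact b1
      _ ≤ m * (1 + μ0) * (μ + 1) * ∑ i, (|y0 i|⁻¹ + |sl A b x0 i|⁻¹) := by
          refine mul_le_mul_of_nonneg_left (le_trans ?_ (hsum i)) (by positivity)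
          have := inv_pos.2 (hs0 i); linarith
      _ = _ := by rw [hC1]; ring
  have hy : ∀ i, |y i| ≤ C1 * (μ + 1) := fun i => by
    have a := hi i
    have b1 : |y i| * |sl A b x0 i| ≤ m * (1 + μ0) * (μ + 1) := by
      have : 0 ≤ |sl A b x i| * |y0 i| := by positivity
      linarith
    calc |y i| ≤ m * (1 + μ0) * (μ + 1) * |sl A b x0 i|⁻¹ := by
          rw [← div_eq_mul_inv, le_div_iff₀ (hs0 i)]; exact b1
      _ ≤ m * (1 + μ0) * (μ + 1) * ∑ i, (|y0 i|⁻¹ + |sl A b x0 i|⁻¹) := by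
          refine mul_le_mul_of_nonneg_left (le_trans ?_ (hsum i)) (by positivity)
          have := inv_pos.2 (hy0 i); linarith
      _ = _ := by rw [hC1]; ring
  refine ⟨fun i => (hs i).trans ?_, fun i => (hy i).trans ?_, fun j => ?_⟩
  · gcongr; linarith
  · gcongr; linarith
  · have : |x j| ≤ C2 * (μ + 1) := by
      rw [hR x j]
      refine (Finset.abs_sum_le_sum_abs _ _).trans ?_
      refine le_trans (b := (∑ i, |R j i| * (C1 + |b i|)) * (μ + 1)) ?_ ?_
      · rw [Finset.sum_mul]
        refine Finset.sum_le_sum fun i _ => ?_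
        rw [abs_mul, mul_assoc]
        refine mul_le_mul_of_nonneg_left ?_ (abs_nonneg _)
        have : ∑ k, A i k * x k = sl A b x i + b i := by unfold sl; ring
        rw [this]
        refine (abs_add_le _ _).trans ?_
        have := hs i
        have : 0 ≤ |b i| * μ := by positivity
        nlinarith
      · gcongr
        exact Finset.single_le_sum (f := fun j => ∑ i, |R j i| * (C1 + |b i|))
          (fun i _ => by positivity) (Finset.mem_univ j)
    refine this.trans ?_
    gcongr; linarith

theorem exists_all {σ : Fin m → Bool} {A : Fin m → Fin n → ℝ} {b c μ0 x0 y0} (hA : Inj A)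
    (h0 : SolS σ A b c μ0 x0 y0) (hμ0 : 0 < μ0) : ∀ μ, 0 < μ → ∃ x y, SolS σ A b c μ x y := by
  obtain ⟨C, hC, hg⟩ := growth hA h0 hμ0
  set M : Set ℝ := {μ | 0 < μ ∧ ∃ x y, SolS σ A b c μ x y} with hM
  have hopen : IsOpen M := by
    rw [isOpen_iff_mem_nhds]
    rintro μ ⟨hμ, x, y, h⟩
    obtain ⟨φ, -, hφ⟩ := SolS.persist (q := (A, b, c, μ)) h hA hμ
    have hc : Tendsto (fun t : ℝ => ((A, b, c, t) : Par m n)) (𝓝 μ) (𝓝 (A, b, c, μ)) := by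
      apply Continuous.tendsto; fun_prop
    filter_upwards [hc.eventually hφ, lt_mem_nhds hμ] with t h1 h2
    exact ⟨h2, _, _, h1⟩
  have hsub : Set.Ioi (0:ℝ) ⊆ M := by
    refine isPreconnected_Ioi.subset_of_closure_inter_subset hopen ⟨μ0, hμ0, hμ0, x0, y0, h0⟩ ?_
    rintro μ ⟨hcl, hμ⟩
    obtain ⟨u, huM, hu⟩ := mem_closure_iff_seq_limit.1 hcl
    choose hupos X Y hXY using huM
    obtain ⟨D, hD⟩ := hu.bddAbove_range
    have hD' : ∀ k, u k ≤ D := fun k => hD ⟨k, rfl⟩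
    have hDn : 0 ≤ C * (D + 1) := by
      have := hupos 0; have := hD' 0
      exact mul_nonneg hC.le (by linarith)
    have hle : ∀ k, C * (u k + 1) ≤ C * (D + 1) := fun k => by
      have := hD' k
      gcongr
    obtain ⟨⟨x, y⟩, -, ψ, hψ, hlim⟩ := tendsto_subseq_of_bounded
      (Metric.isBounded_closedBall (x := (0 : (Fin n → ℝ) × (Fin m → ℝ))) (r := C * (D + 1)))
      (x := fun k => (X k, Y k)) (fun k => by
        obtain ⟨-, h2, h3⟩ := hg _ _ _ (hupos k) (hXY k)
        rw [mem_closedBall_zero_iff, Prod.norm_def, max_le_iff, pi_norm_le_iff_of_nonneg hDn,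
          pi_norm_le_iff_of_nonneg hDn]
        exact ⟨fun j => (h3 j).trans (hle k), fun i => (h2 i).trans (hle k)⟩)
    have hx : Tendsto (fun k => X (ψ k)) atTop (𝓝 x) := (continuous_fst.tendsto (x, y)).comp hlim
    have hy : Tendsto (fun k => Y (ψ k)) atTop (𝓝 y) := (continuous_snd.tendsto (x, y)).comp hlim
    have hs := fun i => tendsto_sl (tendsto_const_nhds (x := A)) (tendsto_const_nhds (x := b)) hx i
    have hu' := hu.comp hψ.tendsto_atTop
    have hcomp : ∀ i, sl A b x i * y i = μ := fun i => by
      refine tendsto_nhds_unique ((hs i).mul (tendsto_pi_nhds.1 hy i)) (hu'.congr fun k => ?_)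
      exact ((hXY (ψ k)).comp i).symm
    refine ⟨hμ, x, y, ⟨fun j => ?_, hcomp⟩, fun i => ?_⟩
    · refine tendsto_nhds_unique (tendsto_finsetSum _ fun i _ => (tendsto_pi_nhds.1 hy i).const_mul (A i j)) ?_
      exact tendsto_const_nhds.congr fun k => ((hXY (ψ k)).dual j).symm
    · have : 0 ≤ sg σ i * sl A b x i :=
        ge_of_tendsto' ((hs i).const_mul (sg σ i)) fun k => ((hXY (ψ k)).sgn i).le
      refine lt_of_le_of_ne this fun h => ?_
      have hs0 : sl A b x i = 0 := by
        rcases mul_eq_zero.1 h.symm with h | h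
        · have := sg_mul_self σ i; rw [h] at this; norm_num at this
        · exact h
      have := hcomp i
      rw [hs0, zero_mul] at this
      exact absurd this.symm (ne_of_gt hμ)
  exact fun μ hμ => (hsub hμ).2

end CP

end

section

namespace CP

variable {m n : ℕ}

structure Gen (A : Fin m → Fin n → ℝ) (b : Fin m → ℝ) (c : Fin n → ℝ) : Prop where
  g1 : ∀ S : Finset (Fin m), S.card = n → ∀ u : Fin n → ℝ, (∀ i ∈ S, ∑ j, A i j * u j = 0) → u = 0
  g2 : ∀ T : Finset (Fin m), T.card = n + 1 → ∀ x : Fin n → ℝ, ∃ i ∈ T, sl A b x i ≠ 0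
  g3 : ∀ T : Finset (Fin m), T.card + 1 = n → ∀ u : Fin n → ℝ, (∀ i ∈ T, ∑ j, A i j * u j = 0) →
    ∑ j, c j * u j = 0 → u = 0

variable {A : Fin m → Fin n → ℝ} {b : Fin m → ℝ} {c : Fin n → ℝ}

lemma Gen.inj (h : Gen A b c) (hmn : n ≤ m) : Inj A := by
  obtain ⟨S, -, hS⟩ := Finset.exists_subset_card_eq (s := (Finset.univ : Finset (Fin m))) (n := n) (by simpa)
  exact fun u hu => h.g1 S hS u fun i _ => hu i

lemma Gen.theta (h : Gen A b c) (S : Finset (Fin m)) (hS : S.card = n) :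
    ∃ θ : Fin m → Fin n → ℝ,
      (∀ i ∈ S, ∀ j ∈ S, ∑ k, A j k * θ i k = if j = i then 1 else 0) ∧
      (∀ (x : Fin n → ℝ) k, x k = ∑ i ∈ S, (∑ l, A i l * x l) * θ i k) := by
  let f : (Fin n → ℝ) →ₗ[ℝ] (S → ℝ) := Matrix.mulVecLin (Matrix.of fun (i : S) j => A i j)
  have hf : ∀ x i, f x i = ∑ k, A i k * x k := by
    intro x i; simp [f, Matrix.mulVec, dotProduct]
  have hinj : Function.Injective f := by
    rw [← LinearMap.ker_eq_bot, LinearMap.ker_eq_bot']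
    intro u hu
    exact h.g1 S hS u fun i hi => by rw [← hf u ⟨i, hi⟩, hu]; rfl
  have hsurj : Function.Surjective f :=
    (LinearMap.injective_iff_surjective_of_finrank_eq_finrank (by simp [hS])).1 hinj
  have : ∀ i : Fin m, ∃ t : Fin n → ℝ, ∀ j ∈ S, ∑ k, A j k * t k = if j = i then 1 else 0 := by
    intro i
    obtain ⟨t, ht⟩ := hsurj (fun j => if (j : Fin m) = i then 1 else 0)
    exact ⟨t, fun j hj => by rw [← hf t ⟨j, hj⟩, ht]⟩
  choose θ hθ using this
  refine ⟨θ, fun i _ j hj => hθ i j hj, fun x k => ?_⟩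
  have := h.g1 S hS (fun k => x k - ∑ i ∈ S, (∑ l, A i l * x l) * θ i k) (fun j hj => by
    simp only [mul_sub, Finset.sum_sub_distrib, Finset.mul_sum]
    rw [Finset.sum_comm]
    have : ∀ i ∈ S, ∑ k, A j k * ((∑ l, A i l * x l) * θ i k) = if j = i then (∑ l, A i l * x l) else 0 := by
      intro i _
      calc ∑ k, A j k * ((∑ l, A i l * x l) * θ i k) = (∑ l, A i l * x l) * ∑ k, A j k * θ i k := by
            rw [Finset.mul_sum]; exact Finset.sum_congr rfl fun k _ => by ring
        _ = _ := by rw [hθ i j hj]; split_ifs <;> simp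
    rw [Finset.sum_congr rfl this]
    simp [hj])
  have := congrFun this k
  simp at this
  linarith

/-- slack in terms of basis slacks -/
lemma Gen.L4 (h : Gen A b c) (S : Finset (Fin m)) (hS : S.card = n) (i : Fin m) :
    ∃ (l : Fin m → ℝ) (k0 : ℝ), ∀ x, sl A b x i = ∑ j ∈ S, l j * sl A b x j + k0 := by
  obtain ⟨θ, -, h2⟩ := h.theta S hS
  refine ⟨fun j => ∑ k, A i k * θ j k, ∑ j ∈ S, (∑ k, A i k * θ j k) * b j - b i, fun x => ?_⟩
  unfold sl
  simp only [mul_sub, Finset.sum_sub_distrib]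
  have : ∑ j, A i j * x j = ∑ j ∈ S, (∑ k, A i k * θ j k) * ∑ l, A j l * x l := by
    calc ∑ j, A i j * x j = ∑ k, A i k * ∑ j ∈ S, (∑ l, A j l * x l) * θ j k := by
          exact Finset.sum_congr rfl fun k _ => by rw [← h2]
      _ = _ := by
          simp_rw [Finset.mul_sum (s := S)]
          rw [Finset.sum_comm]
          refine Finset.sum_congr rfl fun j _ => ?_
          rw [Finset.sum_mul]
          exact Finset.sum_congr rfl fun k _ => by ring
  rw [this]; ring

lemma Gen.vertex (h : Gen A b c) (S : Finset (Fin m)) (hS : S.card = n) :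
    ∃ x, (∀ i ∈ S, sl A b x i = 0) ∧ ∀ i ∉ S, sl A b x i ≠ 0 := by
  obtain ⟨θ, h1, h2⟩ := h.theta S hS
  set x : Fin n → ℝ := fun k => ∑ i ∈ S, b i * θ i k with hx
  have hx0 : ∀ j ∈ S, sl A b x j = 0 := by
    intro j hj
    unfold sl
    have : ∑ k, A j k * x k = ∑ i ∈ S, b i * (if j = i then 1 else 0) := by
      simp only [hx, Finset.mul_sum]
      rw [Finset.sum_comm]
      refine Finset.sum_congr rfl fun i hi => ?_
      rw [← h1 i hi j hj, Finset.mul_sum]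
      exact Finset.sum_congr rfl fun k _ => by ring
    rw [this]; simp [hj]
  refine ⟨x, hx0, fun i hi h0 => ?_⟩
  obtain ⟨k, hk, hk'⟩ := h.g2 (insert i S) (by rw [Finset.card_insert_of_notMem hi, hS]) x
  rcases Finset.mem_insert.1 hk with rfl | hk
  · exact hk' h0
  · exact hk' (hx0 k hk)

lemma Gen.L1 (h : Gen A b c) (T : Finset (Fin m)) (hT : T.card = n + 1) :
    ∃ κ : Fin m → ℝ, ∀ x, ∑ j ∈ T, κ j * sl A b x j = 1 := by
  obtain ⟨i, hi⟩ : T.Nonempty := Finset.card_pos.1 (by omega)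
  have hS : (T.erase i).card = n := by rw [Finset.card_erase_of_mem hi, hT]; rfl
  obtain ⟨l, k0, hl⟩ := h.L4 _ hS i
  obtain ⟨x0, hx0, hx1⟩ := h.vertex _ hS
  have hk : k0 ≠ 0 := by
    have := hl x0
    rw [Finset.sum_eq_zero (fun j hj => by rw [hx0 j hj, mul_zero]), zero_add] at this
    rw [← this]
    exact hx1 i (by simp)
  refine ⟨fun j => if j = i then k0⁻¹ else - l j / k0, fun x => ?_⟩
  rw [← Finset.add_sum_erase _ _ hi]
  have : ∑ j ∈ T.erase i, (if j = i then k0⁻¹ else - l j / k0) * sl A b x j =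
      - (∑ j ∈ T.erase i, l j * sl A b x j) / k0 := by
    rw [neg_div, Finset.sum_div, ← Finset.sum_neg_distrib]
    refine Finset.sum_congr rfl fun j hj => ?_
    rw [if_neg (Finset.ne_of_mem_erase hj)]; ring
  rw [this]
  simp only [if_true]
  rw [hl x]
  field_simp; ring

lemma dual_dot {y : Fin m → ℝ} (hy : ∀ j, ∑ i, A i j * y i = c j) (t : Fin n → ℝ) :
    ∑ j, c j * t j = ∑ k, (∑ l, A k l * t l) * y k := by
  simp_rw [← hy, Finset.sum_mul]
  rw [Finset.sum_comm]
  exact Finset.sum_congr rfl fun i _ => Finset.sum_congr rfl fun j _ => by ring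

lemma Gen.L2 (h : Gen A b c) (S : Finset (Fin m)) (hS : S.card = n) (i : Fin m) (hi : i ∈ S) :
    ∃ (d : Fin m → ℝ) (e : Fin n → ℝ), ∀ (c' : Fin n → ℝ) (y : Fin m → ℝ), (∀ j, ∑ i, A i j * y i = c' j) →
      y i = ∑ j, c' j * e j - ∑ k ∈ Sᶜ, d k * y k := by
  obtain ⟨θ, h1, h2⟩ := h.theta S hS
  refine ⟨fun k => ∑ l, A k l * θ i l, θ i, fun c' y hy => ?_⟩
  rw [dual_dot hy, ← Finset.sum_add_sum_compl S]
  rw [Finset.sum_congr rfl fun k hk => by rw [h1 i hi k hk]]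
  simp [hi]

lemma Gen.L3 (h : Gen A b c) (hmn : n ≤ m) (T : Finset (Fin m)) (hT : T.card + 1 = n) :
    ∃ d : Fin m → ℝ, ∀ y : Fin m → ℝ, (∀ j, ∑ i, A i j * y i = c j) → 1 = ∑ k ∈ Tᶜ, d k * y k := by
  obtain ⟨i, hi⟩ : ∃ i, i ∉ T := by
    by_contra hne
    push Not at hne
    have := Finset.eq_univ_iff_forall.2 hne
    rw [this] at hT; simp at hT; omega
  have hS : (insert i T).card = n := by rw [Finset.card_insert_of_notMem hi, hT]
  obtain ⟨θ, h1, -⟩ := h.theta _ hS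
  have hz : ∀ j ∈ T, ∑ k, A j k * θ i k = 0 := fun j hj => by
    rw [h1 i (by simp) j (by simp [hj]), if_neg]
    rintro rfl; exact hi hj
  have hne : ∑ j, c j * θ i j ≠ 0 := fun h0 => by
    have := h.g3 T hT _ hz h0
    have h5 := h1 i (by simp) i (by simp)
    rw [this] at h5; simp at h5
  refine ⟨fun k => (∑ l, A k l * θ i l) / ∑ j, c j * θ i j, fun y hy => ?_⟩
  have : ∑ k ∈ Tᶜ, (∑ l, A k l * θ i l) / (∑ j, c j * θ i j) * y k =
      (∑ k ∈ Tᶜ, (∑ l, A k l * θ i l) * y k) / (∑ j, c j * θ i j) := by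
    rw [Finset.sum_div]; exact Finset.sum_congr rfl fun k _ => by ring
  rw [this, eq_div_iff hne, one_mul, dual_dot hy, ← Finset.sum_add_sum_compl T]
  rw [Finset.sum_eq_zero (s := T) (fun k hk => by rw [hz k hk, zero_mul]), zero_add]

lemma Gen.dvertex (h : Gen A b c) (S : Finset (Fin m)) (hS : S.card = n) :
    ∃ y : Fin m → ℝ, (∀ j, ∑ i, A i j * y i = c j) ∧ (∀ i ∈ S, y i ≠ 0) ∧ ∀ i ∉ S, y i = 0 := by
  obtain ⟨θ, h1, h2⟩ := h.theta S hS
  refine ⟨fun i => if i ∈ S then ∑ k, c k * θ i k else 0, fun j => ?_, fun i hi => ?_, fun i hi => by simp [hi]⟩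
  · have h3 := h2 (Pi.single j 1)
    have h4 : ∀ i, ∑ l, A i l * (Pi.single j 1 : Fin n → ℝ) l = A i j := fun i => by
      simp [Pi.single_apply]
    simp_rw [h4] at h3
    have h5 : c j = ∑ k, c k * (Pi.single j 1 : Fin n → ℝ) k := by simp [Pi.single_apply]
    rw [h5]
    simp_rw [h3]
    simp only [mul_ite, mul_zero, Finset.mul_sum]
    rw [Finset.sum_comm]
    simp only [Finset.sum_ite_mem, Finset.univ_inter]
    exact Finset.sum_congr rfl fun i _ => Finset.sum_congr rfl fun k _ => by ring
  · simp only [hi, if_true]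
    intro h0
    have := h.g3 (S.erase i) (by rw [Finset.card_erase_add_one hi, hS]) (θ i) (fun j hj => by
      rw [h1 i hi j (Finset.mem_of_mem_erase hj), if_neg (Finset.ne_of_mem_erase hj)]) h0
    have h5 := h1 i hi i hi
    rw [this] at h5; simp at h5

/-- feasible sign patterns -/
def Feas (A : Fin m → Fin n → ℝ) (b : Fin m → ℝ) (c : Fin n → ℝ) (σ : Fin m → Bool) : Prop :=
  ∃ μ x y, 0 < μ ∧ SolS σ A b c μ x y

lemma sg_decide (f : Fin m → ℝ) (i : Fin m) (h : f i ≠ 0) : 0 < sg (fun i => decide (0 < f i)) i * f i := by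
  unfold sg
  by_cases h1 : 0 < f i
  · simp [h1]
  · simp [h1]; push Not at h1; exact lt_of_le_of_ne h1 h

/-- each basis gives a feasible sign pattern, compatible with the vertices -/
lemma Gen.vertex_feas (h : Gen A b c) (S : Finset (Fin m)) (hS : S.card = n) :
    ∃ σ, Feas A b c σ ∧ ∃ (x : Fin n → ℝ) (y : Fin m → ℝ), (∀ j, ∑ i, A i j * y i = c j) ∧ (∀ i ∈ S, sl A b x i = 0 ∧ 0 < sg σ i * y i) ∧
      ∀ i ∉ S, y i = 0 ∧ 0 < sg σ i * sl A b x i := by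
  obtain ⟨x, hx0, hx1⟩ := h.vertex S hS
  obtain ⟨y, hyd, hy1, hy0⟩ := h.dvertex S hS
  set f : Fin m → ℝ := fun i => if i ∈ S then y i else sl A b x i with hf
  have hfne : ∀ i, f i ≠ 0 := fun i => by
    by_cases hi : i ∈ S
    · simp [hf, hi, hy1]
    · simp [hf, hi, hx1]
  set σ : Fin m → Bool := fun i => decide (0 < f i) with hσ
  have hpos := fun i => sg_decide f i (hfne i)
  have hpS : ∀ i ∈ S, 0 < sg σ i * y i := fun i hi => by have := hpos i; simpa [hf, hi] using this
  have hpN : ∀ i ∉ S, 0 < sg σ i * sl A b x i := fun i hi => by have := hpos i; simpa [hf, hi] using this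
  refine ⟨σ, ?_, x, y, hyd, fun i hi => ⟨hx0 i hi, hpS i hi⟩, fun i hi => ⟨hy0 i hi, hpN i hi⟩⟩
  have hsol : IsSol A b c 0 x y := ⟨hyd, fun i => by
    by_cases hi : i ∈ S
    · rw [hx0 i hi, zero_mul]
    · rw [hy0 i hi, mul_zero]⟩
  have hnd : Nondeg A b x y := by
    intro u z h1 h2
    have hu : u = 0 := h.g1 S hS u fun i hi => by
      have := h1 i
      rw [hx0 i hi, zero_mul, add_zero] at this
      exact (mul_eq_zero.1 this).resolve_right (hy1 i hi)
    refine ⟨hu, ?_⟩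
    have hz : ∀ i ∉ S, z i = 0 := fun i hi => by
      have := h1 i
      rw [hy0 i hi, mul_zero, zero_add] at this
      exact (mul_eq_zero.1 this).resolve_left (hx1 i hi)
    funext i
    by_cases hi : i ∈ S
    · obtain ⟨d, e, hde⟩ := h.L2 S hS i hi
      rw [hde 0 z h2, Finset.sum_eq_zero (s := Sᶜ)
        (fun k hk => by rw [hz k (Finset.mem_compl.1 hk), mul_zero])]
      simp
    · exact hz i hi
  obtain ⟨φ, hφ, hev⟩ := ift (A, b, c, 0) x y hsol hnd
  have hc : Tendsto (fun t : ℝ => ((A, b, c, t) : Par m n)) (𝓝[>] 0) (𝓝 (A, b, c, 0)) := by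
    refine (Continuous.tendsto ?_ (0:ℝ)).mono_left nhdsWithin_le_nhds
    fun_prop
  have hφ' := hφ.comp hc
  have hφx : Tendsto (fun t : ℝ => (φ (A, b, c, t)).1) (𝓝[>] 0) (𝓝 x) := (continuous_fst.tendsto (x, y)).comp hφ'
  have hφy : Tendsto (fun t : ℝ => (φ (A, b, c, t)).2) (𝓝[>] 0) (𝓝 y) := (continuous_snd.tendsto (x, y)).comp hφ'
  have e1 : ∀ᶠ t in 𝓝[>] (0:ℝ), ∀ i, i ∈ S → 0 < sg σ i * (φ (A, b, c, t)).2 i := by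
    rw [eventually_all]
    intro i
    by_cases hi : i ∈ S
    · filter_upwards [((tendsto_pi_nhds.1 hφy i).const_mul (sg σ i)).eventually_const_lt (hpS i hi)] with t ht _
      exact ht
    · exact Eventually.of_forall fun t h => absurd h hi
  have e2 : ∀ᶠ t in 𝓝[>] (0:ℝ), ∀ i, i ∉ S → 0 < sg σ i * sl A b (φ (A, b, c, t)).1 i := by
    rw [eventually_all]
    intro i
    by_cases hi : i ∉ S
    · filter_upwards [((tendsto_sl (tendsto_const_nhds (x := A)) (tendsto_const_nhds (x := b)) hφx i).const_mul
        (sg σ i)).eventually_const_lt (hpN i hi)] with t ht _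
      exact ht
    · exact Eventually.of_forall fun t h => absurd h hi
  obtain ⟨t, ht1, ht2, ht3, ht4⟩ := ((hc.eventually hev).and (e1.and (e2.and self_mem_nhdsWithin))).exists
  have ht4 : 0 < t := ht4
  refine ⟨t, _, _, ht4, ht1, fun i => ?_⟩
  by_cases hi : i ∈ S
  · have a := ht2 i hi
    have e := ht1.comp i
    simp only at e
    by_contra hn
    push Not at hn
    have : (sg σ i * sl A b (φ (A, b, c, t)).1 i) * (sg σ i * (φ (A, b, c, t)).2 i) = t := by
      linear_combination e + (sl A b (φ (A, b, c, t)).1 i * (φ (A, b, c, t)).2 i) * sg_mul_self σ i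
    nlinarith
  · exact ht3 i hi

lemma Gen.card_le (h : Gen A b c) :
    Fintype.card {S : Finset (Fin m) // S.card = n} ≤ Nat.card {σ // Feas A b c σ} := by
  classical
  choose σ hσ x y hd h1 h2 using fun S : {S : Finset (Fin m) // S.card = n} => h.vertex_feas S.1 S.2
  rw [← Nat.card_eq_fintype_card]
  refine Nat.card_le_card_of_injective (fun S => (⟨σ S, hσ S⟩ : {σ // Feas A b c σ})) ?_
  intro S S' he
  have he : σ S = σ S' := congrArg Subtype.val he
  have ho := orth b (x S) (x S') (hd S) (hd S')
  have e : ∀ i, (sl A b (x S) i - sl A b (x S') i) * (y S i - y S' i) =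
      - (|sl A b (x S) i| * |y S' i| + |sl A b (x S') i| * |y S i|) := by
    intro i
    have z1 : sl A b (x S) i * y S i = 0 := by
      by_cases hi : i ∈ S.1
      · rw [(h1 S i hi).1, zero_mul]
      · rw [(h2 S i hi).1, mul_zero]
    have z2 : sl A b (x S') i * y S' i = 0 := by
      by_cases hi : i ∈ S'.1
      · rw [(h1 S' i hi).1, zero_mul]
      · rw [(h2 S' i hi).1, mul_zero]
    have n1 : 0 ≤ sg (σ S) i * sl A b (x S) i := by
      by_cases hi : i ∈ S.1
      · rw [(h1 S i hi).1, mul_zero]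
      · exact (h2 S i hi).2.le
    have n2 : 0 ≤ sg (σ S) i * y S i := by
      by_cases hi : i ∈ S.1
      · exact (h1 S i hi).2.le
      · rw [(h2 S i hi).1, mul_zero]
    have n3 : 0 ≤ sg (σ S) i * sl A b (x S') i := by
      rw [he]
      by_cases hi : i ∈ S'.1
      · rw [(h1 S' i hi).1, mul_zero]
      · exact (h2 S' i hi).2.le
    have n4 : 0 ≤ sg (σ S) i * y S' i := by
      rw [he]
      by_cases hi : i ∈ S'.1
      · exact (h1 S' i hi).2.le
      · rw [(h2 S' i hi).1, mul_zero]
    rw [← sg_mul_mul n1 n4, ← sg_mul_mul n3 n2]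
    linear_combination z1 + z2
  simp_rw [e] at ho
  rw [Finset.sum_neg_distrib, neg_eq_zero, Finset.sum_eq_zero_iff_of_nonneg (fun i _ => by positivity)] at ho
  have hsub : S'.1 ⊆ S.1 := by
    intro i hi
    by_contra hn
    have a := (h1 S' i hi).2
    have b' := (h2 S i hn).2
    have a' : 0 < |y S' i| := abs_pos.2 fun h => by simp [h] at a
    have b' : 0 < |sl A b (x S) i| := abs_pos.2 fun h => by simp [h] at b'
    have := ho i (Finset.mem_univ _)
    nlinarith [mul_pos b' a', mul_nonneg (abs_nonneg (sl A b (x S') i)) (abs_nonneg (y S i))]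
  exact Subtype.ext (Finset.eq_of_subset_of_card_le hsub (by rw [S.2, S'.2])).symm

end CP

end

section

namespace CP

open Polynomial in
lemma poly_deg_le (p : ℝ[X]) (C : ℝ) (K : ℕ) (h : ∀ μ : ℝ, 1 ≤ μ → |p.eval μ| ≤ C * μ ^ K) :
    p.natDegree ≤ K := by
  by_contra hlt
  push Not at hlt
  have h1 : (fun μ : ℝ => p.eval μ) =O[atTop] (fun μ : ℝ => (X ^ K : ℝ[X]).eval μ) := by
    refine Asymptotics.IsBigO.of_bound C ?_
    filter_upwards [eventually_ge_atTop 1] with μ hμ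
    have := h μ hμ
    have h0 : 0 ≤ μ ^ K := by positivity
    simpa [abs_of_nonneg (by linarith : 0 ≤ μ)] using this
  have h2 : (fun μ : ℝ => (X ^ K : ℝ[X]).eval μ) =o[atTop] (fun μ : ℝ => p.eval μ) := by
    apply Polynomial.isLittleO_atTop_of_degree_lt
    rw [degree_X_pow]
    have hp0 : p ≠ 0 := by rintro rfl; simp at hlt
    rw [degree_eq_natDegree hp0]; exact_mod_cast hlt
  have h3 := h1.trans_isLittleO h2
  have h4 : p = 0 := by
    by_contra hp
    have := (Asymptotics.isLittleO_irrefl (l := atTop) (f'' := fun μ : ℝ => p.eval μ) ?_) h3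
    · exact this
    · have := p.eventually_atTop_not_isRoot hp
      exact this.frequently
  rw [h4] at hlt; simp at hlt

open Polynomial in
lemma le_poly_deg (p : ℝ[X]) (C : ℝ) (hC : 0 < C) (K : ℕ) (h : ∀ μ : ℝ, 1 ≤ μ → C * μ ^ K ≤ |p.eval μ|) :
    K ≤ p.natDegree := by
  by_contra hlt
  push Not at hlt
  have h1 : (fun μ : ℝ => (X ^ K : ℝ[X]).eval μ) =O[atTop] (fun μ : ℝ => p.eval μ) := by
    refine Asymptotics.IsBigO.of_bound C⁻¹ ?_
    filter_upwards [eventually_ge_atTop 1] with μ hμ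
    have := h μ hμ
    have h0 : 0 ≤ μ ^ K := by positivity
    rw [Real.norm_eq_abs, Real.norm_eq_abs, eval_pow, eval_X, abs_of_nonneg h0, le_inv_mul_iff₀ hC]
    exact this
  have h2 : (fun μ : ℝ => p.eval μ) =o[atTop] (fun μ : ℝ => (X ^ K : ℝ[X]).eval μ) := by
    apply Polynomial.isLittleO_atTop_of_degree_lt
    rw [degree_X_pow]
    exact lt_of_le_of_lt degree_le_natDegree (by exact_mod_cast hlt)
  have h3 := h1.trans_isLittleO h2
  refine (Asymptotics.isLittleO_irrefl (l := atTop) (f'' := fun μ : ℝ => (X ^ K : ℝ[X]).eval μ) ?_) h3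
  refine Eventually.frequently ?_
  filter_upwards [eventually_ge_atTop 1] with μ hμ
  have : 0 < μ := by linarith
  simp; intro h; linarith

section rep
variable {Ω ι : Type*} [Fintype ι] [DecidableEq ι] (w : Ω → ℝ → ι → ℝ)

open Polynomial

def RepBy (F : Matrix ι ι ℝ[X]) (f : Ω → ℝ → ℝ) : Prop :=
  ∀ ω μ, 0 < μ → (F.map (eval μ)) *ᵥ w ω μ = f ω μ • w ω μ

def Rep (f : Ω → ℝ → ℝ) : Prop := ∃ F, RepBy w F f

def Rep0 (v : Ω → ι → ℝ) (f : Ω → ℝ) : Prop := ∃ M : Matrix ι ι ℝ, ∀ ω, M *ᵥ v ω = f ω • v ω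

variable {w}

lemma map_eval_eq (μ : ℝ) (F : Matrix ι ι ℝ[X]) : F.map (eval μ) = (evalRingHom μ).mapMatrix F := rfl

lemma Rep.const (r : ℝ) : Rep w (fun _ _ => r) := by
  refine ⟨Matrix.diagonal fun _ => C r, fun ω μ _ => ?_⟩
  ext i
  simp [Matrix.diagonal_map, Matrix.mulVec_diagonal]

lemma Rep.add {f g : Ω → ℝ → ℝ} (hf : Rep w f) (hg : Rep w g) : Rep w (fun ω μ => f ω μ + g ω μ) := by
  obtain ⟨F, hF⟩ := hf
  obtain ⟨G, hG⟩ := hg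
  refine ⟨F + G, fun ω μ hμ => ?_⟩
  rw [map_eval_eq, map_add, Matrix.add_mulVec, ← map_eval_eq, ← map_eval_eq, hF ω μ hμ, hG ω μ hμ, add_smul]

lemma Rep.mul {f g : Ω → ℝ → ℝ} (hf : Rep w f) (hg : Rep w g) : Rep w (fun ω μ => f ω μ * g ω μ) := by
  obtain ⟨F, hF⟩ := hf
  obtain ⟨G, hG⟩ := hg
  refine ⟨F * G, fun ω μ hμ => ?_⟩
  rw [map_eval_eq, map_mul, ← Matrix.mulVec_mulVec, ← map_eval_eq, ← map_eval_eq, hG ω μ hμ,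
    Matrix.mulVec_smul, hF ω μ hμ, smul_smul, mul_comm]

lemma Rep.sum {α : Type*} (s : Finset α) (f : α → Ω → ℝ → ℝ) (h : ∀ a ∈ s, Rep w (f a)) :
    Rep w (fun ω μ => ∑ a ∈ s, f a ω μ) := by
  classical
  induction s using Finset.induction_on with
  | empty => simpa using Rep.const 0
  | insert a s ha ih =>
    simp only [Finset.sum_insert ha]
    exact (h a (by simp)).add (ih fun b hb => h b (by simp [hb]))

lemma Rep.prod {α : Type*} (s : Finset α) (f : α → Ω → ℝ → ℝ) (h : ∀ a ∈ s, Rep w (f a)) :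
    Rep w (fun ω μ => ∏ a ∈ s, f a ω μ) := by
  classical
  induction s using Finset.induction_on with
  | empty => simpa using Rep.const 1
  | insert a s ha ih =>
    simp only [Finset.prod_insert ha]
    exact (h a (by simp)).mul (ih fun b hb => h b (by simp [hb]))

lemma Rep.det {κ : Type*} [Fintype κ] [DecidableEq κ] (f : κ → κ → Ω → ℝ → ℝ) (h : ∀ a b, Rep w (f a b)) :
    Rep w (fun ω μ => (Matrix.of fun a b => f a b ω μ).det) := by
  simp only [Matrix.det_apply']
  refine Rep.sum _ _ fun σ _ => ?_
  exact (Rep.const ((Equiv.Perm.sign σ : ℤ) : ℝ)).mul (Rep.prod _ (fun i ω μ => f (σ i) i ω μ) fun i _ => h _ _)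

lemma Rep0.mul {v : Ω → ι → ℝ} {f g : Ω → ℝ} (hf : Rep0 v f) (hg : Rep0 v g) : Rep0 v (fun ω => f ω * g ω) := by
  obtain ⟨F, hF⟩ := hf
  obtain ⟨G, hG⟩ := hg
  refine ⟨F * G, fun ω => ?_⟩
  rw [← Matrix.mulVec_mulVec, hG, Matrix.mulVec_smul, hF, smul_smul, mul_comm]

lemma Rep0.sub_const {v : Ω → ι → ℝ} {f : Ω → ℝ} (hf : Rep0 v f) (r : ℝ) : Rep0 v (fun ω => f ω - r) := by
  obtain ⟨F, hF⟩ := hf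
  refine ⟨F - r • 1, fun ω => ?_⟩
  rw [Matrix.sub_mulVec, hF, Matrix.smul_mulVec, Matrix.one_mulVec, sub_smul]

lemma Rep0.prod {v : Ω → ι → ℝ} {α : Type*} (s : Finset α) (f : α → Ω → ℝ) (h : ∀ a ∈ s, Rep0 v (f a)) :
    Rep0 v (fun ω => ∏ a ∈ s, f a ω) := by
  classical
  induction s using Finset.induction_on with
  | empty => exact ⟨1, fun ω => by simp⟩
  | insert a s ha ih =>
    simp only [Finset.prod_insert ha]
    exact (h a (by simp)).mul (ih fun b hb => h b (by simp [hb]))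

lemma Rep0.linInd [Fintype Ω] (v : Ω → ι → ℝ) (hv : ∀ ω, v ω ≠ 0)
    (hsep : ∀ ω ω', ω ≠ ω' → ∃ f, Rep0 v f ∧ f ω ≠ f ω') : LinearIndependent ℝ v := by
  classical
  rw [Fintype.linearIndependent_iff]
  intro a ha ω0
  have hsep' : ∀ ω', ∃ f, Rep0 v f ∧ (ω' ≠ ω0 → f ω' = 0) ∧ f ω0 ≠ 0 := by
    intro ω'
    by_cases he : ω' = ω0
    · exact ⟨fun _ => 1, ⟨1, fun ω => by simp⟩, fun h => absurd he h, one_ne_zero⟩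
    · obtain ⟨f, hf, hne⟩ := hsep ω0 ω' (Ne.symm he)
      exact ⟨fun ω => f ω - f ω', hf.sub_const _, fun _ => sub_self _, sub_ne_zero.2 hne⟩
  choose f hf h0 h1 using hsep'
  obtain ⟨M, hM⟩ := Rep0.prod (v := v) Finset.univ f (fun ω _ => hf ω)
  have := congrArg (fun z => M *ᵥ z) ha
  simp only [Matrix.mulVec_sum, Matrix.mulVec_smul, hM, Matrix.mulVec_zero] at this
  rw [Finset.sum_eq_single ω0] at this
  · rw [smul_smul, smul_eq_zero, or_iff_left (hv ω0), mul_eq_zero] at this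
    exact this.resolve_right (Finset.prod_ne_zero_iff.2 fun ω _ => h1 ω)
  · intro ω _ hω
    rw [Finset.prod_eq_zero (f := fun a => f a ω) (Finset.mem_univ ω) (h0 ω hω)]; simp
  · simp

/-- the matrix of eigenvectors -/
def WM (w : Ω → ℝ → ι → ℝ) (e : ι ≃ Ω) (μ : ℝ) : Matrix ι ι ℝ := Matrix.of fun i j => w (e j) μ i

lemma RepBy.mul_WM {F : Matrix ι ι ℝ[X]} {f : Ω → ℝ → ℝ} (h : RepBy w F f) (e : ι ≃ Ω) {μ : ℝ} (hμ : 0 < μ) :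
    F.map (eval μ) * WM w e μ = WM w e μ * Matrix.diagonal (fun j => f (e j) μ) := by
  ext i j
  have := congrFun (h (e j) μ hμ) i
  rw [Matrix.mul_diagonal, Matrix.mul_apply]
  simp only [Matrix.mulVec, dotProduct] at this
  simp only [WM, Matrix.of_apply]
  rw [this]; simp [mul_comm]

lemma RepBy.det_eval [Fintype Ω] {F : Matrix ι ι ℝ[X]} {f : Ω → ℝ → ℝ} (h : RepBy w F f) (e : ι ≃ Ω) {μ : ℝ} (hμ : 0 < μ)
    (hW : (WM w e μ).det ≠ 0) : F.det.eval μ = ∏ ω, f ω μ := by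
  have h1 := congrArg Matrix.det (h.mul_WM e hμ)
  rw [Matrix.det_mul, Matrix.det_mul, Matrix.det_diagonal, mul_comm, Equiv.prod_comp e (fun ω => f ω μ)] at h1
  have h2 := mul_left_cancel₀ hW h1
  rw [← h2, map_eval_eq, ← RingHom.map_det]; rfl

lemma RepBy.dvd {F : Matrix ι ι ℝ[X]} {f : Ω → ℝ → ℝ} (h : RepBy w F f) (e : ι ≃ Ω) {μ : ℝ} (hμ : 0 < μ)
    (hW : (WM w e μ).det ≠ 0) (Z : Finset ι) (hZ : ∀ j ∈ Z, f (e j) μ = 0) :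
    (X - C μ) ^ Z.card ∣ F.det := by
  set W : Matrix ι ι ℝ[X] := (WM w e μ).map C with hWdef
  have hdetW : W.det = C (WM w e μ).det := by
    rw [hWdef]; exact ((C : ℝ →+* ℝ[X]).map_det _).symm
  set d : ι → ℝ[X] := fun j => if j ∈ Z then X - C μ else 1 with hd
  have hdiv : ∀ i j, ∃ g, (F * W) i j = g * d j := by
    intro i j
    by_cases hj : j ∈ Z
    · simp only [hd, hj, if_true]
      have : (F * W) i j |>.IsRoot μ := by
        have h1 := congrFun (congrFun (h.mul_WM e hμ) i) j
        rw [Matrix.mul_diagonal, hZ j hj, mul_zero] at h1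
        rw [IsRoot, Matrix.mul_apply, eval_finsetSum]
        rw [Matrix.mul_apply] at h1
        simpa [hWdef] using h1
      obtain ⟨g, hg⟩ := dvd_iff_isRoot.2 this
      exact ⟨g, by rw [hg, mul_comm]⟩
    · exact ⟨(F * W) i j, by simp [hd, hj]⟩
  choose G hG using hdiv
  have h1 : F * W = Matrix.of G * Matrix.diagonal d := by
    ext1 i j
    rw [Matrix.mul_diagonal, hG]; rfl
  have h2 := congrArg Matrix.det h1
  rw [Matrix.det_mul, Matrix.det_mul, Matrix.det_diagonal, hdetW] at h2
  have h3 : ∏ j, d j = (X - C μ) ^ Z.card := by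
    simp [hd, Finset.prod_ite_mem]
  rw [h3] at h2
  have hu : IsUnit (C (WM w e μ).det) := isUnit_C.2 (isUnit_iff_ne_zero.2 hW)
  have : (X - C μ) ^ Z.card ∣ F.det * C (WM w e μ).det := ⟨_, by rw [h2, mul_comm]⟩
  exact (hu.dvd_mul_right).1 this

lemma RepBy.count {F : Matrix ι ι ℝ[X]} {f : Ω → ℝ → ℝ} (h : RepBy w F f) (e : ι ≃ Ω)
    (hW : ∀ μ, 0 < μ → (WM w e μ).det ≠ 0) (hF : F.det ≠ 0) (Z : Finset (Ω × ℝ))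
    (hZ : ∀ z ∈ Z, 0 < z.2 ∧ f z.1 z.2 = 0) : Z.card ≤ F.det.natDegree := by
  classical
  have key : ∀ μ ∈ Z.image Prod.snd, (Z.filter fun z => z.2 = μ).card ≤ F.det.roots.count μ := by
    intro μ hμ
    obtain ⟨z, hz, rfl⟩ := Finset.mem_image.1 hμ
    have hpos := (hZ z hz).1
    rw [count_roots, le_rootMultiplicity_iff hF]
    set Zi : Finset ι := (Z.filter fun z' => z'.2 = z.2).image (fun z' => e.symm z'.1) with hZi
    have hc : Zi.card = (Z.filter fun z' => z'.2 = z.2).card := by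
      refine Finset.card_image_of_injOn ?_
      intro a ha b hb hab
      simp only [Finset.coe_filter, Set.mem_setOf_eq] at ha hb
      exact Prod.ext (e.symm.injective hab) (ha.2.trans hb.2.symm)
    rw [← hc]
    refine h.dvd e hpos (hW _ hpos) Zi fun j hj => ?_
    obtain ⟨a, ha, rfl⟩ := Finset.mem_image.1 hj
    rw [Finset.mem_filter] at ha
    rw [e.apply_symm_apply, ← ha.2]
    exact (hZ a ha.1).2
  calc Z.card = ∑ μ ∈ Z.image Prod.snd, (Z.filter fun z => z.2 = μ).card :=
        Finset.card_eq_sum_card_image _ _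
    _ ≤ ∑ μ ∈ Z.image Prod.snd, F.det.roots.count μ := Finset.sum_le_sum key
    _ ≤ F.det.roots.card := by
        rw [← Multiset.toFinset_sum_count_eq]
        refine Finset.sum_le_sum_of_ne_zero fun μ _ h0 => ?_
        rw [Multiset.mem_toFinset]; exact Multiset.count_ne_zero.1 h0
    _ ≤ _ := card_roots' _

lemma det_deg {κ : Type*} [Fintype κ] [DecidableEq κ] (K : Matrix ι ι ℝ) (P : Matrix ι κ ℝ) (Q : Matrix κ ι ℝ) :
    (K.map C + (X : ℝ[X]) • (P.map C * Q.map C)).det.natDegree ≤ Fintype.card κ := by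
  have h1 : K.map C + (X : ℝ[X]) • (P.map C * Q.map C) = K.map C - ((-X : ℝ[X]) • P.map C) * Q.map C := by
    rw [Matrix.smul_mul, neg_smul, sub_neg_eq_add]
  rw [h1, ← Matrix.det_fromBlocks_one₂₂]
  set M := Matrix.fromBlocks (K.map C) ((-X : ℝ[X]) • P.map C) (Q.map C) (1 : Matrix κ κ ℝ[X]) with hM
  rw [Matrix.det_apply]
  refine natDegree_sum_le_of_forall_le _ _ fun σ _ => ?_
  refine (natDegree_smul_le _ _).trans ((natDegree_prod_le _ _).trans ?_)
  have hle : ∀ i, (M (σ i) i).natDegree ≤ Sum.elim (fun _ => 0) (fun _ => 1) i := by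
    rintro (i | i)
    · rcases σ (Sum.inl i) with j | j <;> simp [hM]
    · rcases σ (Sum.inr i) with j | j
      · simp only [hM, Matrix.fromBlocks_apply₁₂, Matrix.smul_apply, Matrix.map_apply, smul_eq_mul, Sum.elim_inr]
        refine natDegree_mul_le.trans ?_
        simp
      · simp [hM, Matrix.one_apply]
        split_ifs <;> simp
  calc _ ≤ ∑ i, Sum.elim (fun _ => 0) (fun _ => 1) i := Finset.sum_le_sum fun i _ => hle i
    _ = _ := by simp

end rep

end CP

end

section

namespace CP

variable {m n : ℕ}

abbrev Bs (m n : ℕ) := {S : Finset (Fin m) // S.card = n}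

abbrev Om (A : Fin m → Fin n → ℝ) (b : Fin m → ℝ) (c : Fin n → ℝ) := {σ : Fin m → Bool // Feas A b c σ}

/-- monomials in the dual variables -/
def mon (y : Fin m → ℝ) (S : Finset (Fin m)) : ℝ := ∏ i ∈ S, y i

lemma mon_insert (y : Fin m → ℝ) {S : Finset (Fin m)} {i : Fin m} (h : i ∉ S) :
    mon y (insert i S) = y i * mon y S := Finset.prod_insert h

lemma mon_erase (y : Fin m → ℝ) {S : Finset (Fin m)} {i : Fin m} (h : i ∈ S) :
    y i * mon y (S.erase i) = mon y S := Finset.mul_prod_erase S y h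

lemma lin_help {β α : Type*} [DecidableEq β] (p : β → Prop) [Fintype {x // p x}] (T : Finset α) (a : α → ℝ)
    (g : α → β) (hg : ∀ j ∈ T, p (g j)) :
    ∃ q : {x // p x} → ℝ, ∀ v : β → ℝ, ∑ S, q S * v S.1 = ∑ j ∈ T, a j * v (g j) := by
  refine ⟨fun S => ∑ j ∈ T, if g j = S.1 then a j else 0, fun v => ?_⟩
  simp_rw [Finset.sum_mul]
  rw [Finset.sum_comm]
  refine Finset.sum_congr rfl fun j hj => ?_
  rw [Finset.sum_eq_single ⟨g j, hg j hj⟩]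
  · simp
  · intro S _ hS
    rw [if_neg, zero_mul]
    intro h; exact hS (Subtype.ext h.symm)
  · simp

open Polynomial in
lemma repKPQ {Ω ι κ : Type*} [Fintype ι] [DecidableEq ι] [Fintype κ] [DecidableEq κ] (w : Ω → ℝ → ι → ℝ)
    (f : Ω → ℝ → ℝ) (ρ : Ω → ℝ → κ → ℝ)
    (h1 : ∀ a : κ, ∃ q : ι → ℝ, ∀ ω μ, 0 < μ → ∑ S, q S * w ω μ S = ρ ω μ a)
    (h2 : ∀ S : ι, ∃ (k : ℝ) (p : κ → ℝ), ∀ ω μ, 0 < μ → k * w ω μ S + μ * ∑ a, p a * ρ ω μ a = f ω μ * w ω μ S) :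
    ∃ F, RepBy w F f ∧ F.det.natDegree ≤ Fintype.card κ := by
  choose q hq using h1
  choose k p hp using h2
  refine ⟨_, ?_, det_deg (Matrix.diagonal k) (Matrix.of p) (Matrix.of q)⟩
  intro ω μ hμ
  have e : ((Matrix.diagonal k).map C + (X : ℝ[X]) • ((Matrix.of p).map C * (Matrix.of q).map C)).map (eval μ)
      = Matrix.diagonal k + μ • (Matrix.of p * Matrix.of q) := by
    ext i j
    simp [Matrix.mul_apply, eval_finsetSum, Matrix.diagonal_apply, apply_ite (eval μ)]
  rw [e, Matrix.add_mulVec, Matrix.smul_mulVec, ← Matrix.mulVec_mulVec]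
  have e2 : Matrix.of q *ᵥ w ω μ = ρ ω μ := by
    funext a; rw [← hq a ω μ hμ]; rfl
  rw [e2]
  funext S
  simp only [Pi.add_apply, Pi.smul_apply, Matrix.mulVec_diagonal, smul_eq_mul]
  rw [← hp S ω μ hμ]; rfl

variable {A : Fin m → Fin n → ℝ} {b : Fin m → ℝ} {c : Fin n → ℝ}

lemma card_k1 (i : Fin m) : Fintype.card {T : Finset (Fin m) // T.card = n + 1 ∧ i ∈ T} ≤ (m - 1).choose n := by
  have : (m - 1).choose n = ((Finset.univ.erase i).powersetCard n).card := by
    rw [Finset.card_powersetCard, Finset.card_erase_of_mem (Finset.mem_univ _)]; simp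
  rw [this, ← Finset.card_univ]
  refine Finset.card_le_card_of_injOn (fun T => T.1.erase i) ?_ ?_
  · intro T _
    simp only [Finset.mem_coe, Finset.mem_powersetCard]
    refine ⟨Finset.erase_subset_erase _ (Finset.subset_univ _), ?_⟩
    rw [Finset.card_erase_of_mem T.2.2, T.2.1]; rfl
  · intro T _ T' _ h
    refine Subtype.ext ?_
    rw [← Finset.insert_erase T.2.2, ← Finset.insert_erase T'.2.2]
    simp only at h
    rw [h]

lemma card_k2 (i : Fin m) : Fintype.card {T : Finset (Fin m) // T.card + 1 = n ∧ i ∉ T} ≤ (m - 1).choose (n - 1) := by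
  have : (m - 1).choose (n - 1) = ((Finset.univ.erase i).powersetCard (n - 1)).card := by
    rw [Finset.card_powersetCard, Finset.card_erase_of_mem (Finset.mem_univ _)]; simp
  rw [this, ← Finset.card_univ]
  refine Finset.card_le_card_of_injOn (fun T => T.1) ?_ ?_
  · intro T _
    simp only [Finset.mem_coe, Finset.mem_powersetCard]
    refine ⟨fun j hj => Finset.mem_erase.2 ⟨?_, Finset.mem_univ _⟩, ?_⟩
    · rintro rfl; exact T.2.2 hj
    · have := T.2.1; omega
  · intro T _ T' _ h
    exact Subtype.ext h

variable {X : Om A b c → ℝ → Fin n → ℝ} {Y : Om A b c → ℝ → Fin m → ℝ}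

abbrev ww (Y : Om A b c → ℝ → Fin m → ℝ) : Om A b c → ℝ → Bs m n → ℝ := fun ω μ S => mon (Y ω μ) S.1

theorem Gen.rep_y (h : Gen A b c) (hXY : ∀ ω μ, 0 < μ → SolS ω.1 A b c μ (X ω μ) (Y ω μ)) (i : Fin m) :
    ∃ F, RepBy (ww Y) F (fun ω μ => Y ω μ i) ∧ F.det.natDegree ≤ (m - 1).choose n := by
  have key := repKPQ (κ := {T : Finset (Fin m) // T.card = n + 1 ∧ i ∈ T}) (ww Y)
    (fun ω μ => Y ω μ i) (fun ω μ T => μ⁻¹ * mon (Y ω μ) T.1) ?_ ?_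
  · obtain ⟨F, hF, hd⟩ := key
    exact ⟨F, hF, hd.trans (card_k1 i)⟩
  · rintro ⟨T, hT, hi⟩
    obtain ⟨κ, hκ⟩ := h.L1 T hT
    obtain ⟨q, hq⟩ := lin_help (fun S : Finset (Fin m) => S.card = n) T κ (fun j => T.erase j) (fun j hj => by
      rw [Finset.card_erase_of_mem hj, hT]; rfl)
    refine ⟨q, fun ω μ hμ => ?_⟩
    rw [hq (mon (Y ω μ)), eq_inv_mul_iff_mul_eq₀ hμ.ne', Finset.mul_sum]
    calc ∑ j ∈ T, μ * (κ j * mon (Y ω μ) (T.erase j)) = ∑ j ∈ T, κ j * sl A b (X ω μ) j * mon (Y ω μ) T := by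
          refine Finset.sum_congr rfl fun j hj => ?_
          have e1 := (hXY ω μ hμ).comp j
          have e2 := mon_erase (Y ω μ) hj
          rw [← e2]
          linear_combination - (κ j * mon (Y ω μ) (T.erase j)) * e1
      _ = _ := by rw [← Finset.sum_mul, hκ, one_mul]
  · rintro ⟨S, hS⟩
    by_cases hi : i ∈ S
    · obtain ⟨d, e, hde⟩ := h.L2 S hS i hi
      obtain ⟨p, hp⟩ := lin_help (fun T : Finset (Fin m) => T.card = n + 1 ∧ i ∈ T) Sᶜ (fun k => - d k)
        (fun k => insert k S) (fun k hk => ⟨by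
          rw [Finset.card_insert_of_notMem (Finset.mem_compl.1 hk), hS], by simp [hi]⟩)
      refine ⟨∑ j, c j * e j, p, fun ω μ hμ => ?_⟩
      rw [hp (fun T => μ⁻¹ * mon (Y ω μ) T), hde c _ (hXY ω μ hμ).dual, sub_mul, sub_eq_add_neg,
        Finset.sum_mul (s := Sᶜ), Finset.mul_sum (s := Sᶜ), ← Finset.sum_neg_distrib]
      congr 1
      refine Finset.sum_congr rfl fun k hk => ?_
      rw [mon_insert _ (Finset.mem_compl.1 hk)]
      field_simp
    · obtain ⟨p, hp⟩ := lin_help (fun T : Finset (Fin m) => T.card = n + 1 ∧ i ∈ T) {()} (fun _ => 1)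
        (fun k => insert i S) (fun k hk => ⟨by
          rw [Finset.card_insert_of_notMem hi, hS], by simp⟩)
      refine ⟨0, p, fun ω μ hμ => ?_⟩
      rw [hp (fun T => μ⁻¹ * mon (Y ω μ) T)]
      simp only [Finset.sum_singleton, mon_insert _ hi]
      field_simp
      simp

theorem Gen.rep_s (h : Gen A b c) (hmn : n ≤ m) (hXY : ∀ ω μ, 0 < μ → SolS ω.1 A b c μ (X ω μ) (Y ω μ)) (i : Fin m) :
    ∃ F, RepBy (ww Y) F (fun ω μ => sl A b (X ω μ) i) ∧ F.det.natDegree ≤ (m - 1).choose (n - 1) := by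
  have key := repKPQ (κ := {T : Finset (Fin m) // T.card + 1 = n ∧ i ∉ T}) (ww Y)
    (fun ω μ => sl A b (X ω μ) i) (fun ω μ T => mon (Y ω μ) T.1) ?_ ?_
  · obtain ⟨F, hF, hd⟩ := key
    exact ⟨F, hF, hd.trans (card_k2 i)⟩
  · rintro ⟨T, hT, hi⟩
    obtain ⟨d, hd⟩ := h.L3 hmn T hT
    obtain ⟨q, hq⟩ := lin_help (fun S : Finset (Fin m) => S.card = n) Tᶜ d (fun j => insert j T) (fun j hj => by
      rw [Finset.card_insert_of_notMem (Finset.mem_compl.1 hj), hT])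
    refine ⟨q, fun ω μ hμ => ?_⟩
    rw [hq (mon (Y ω μ))]
    calc ∑ j ∈ Tᶜ, (d j * mon (Y ω μ) (insert j T)) = ∑ j ∈ Tᶜ, d j * Y ω μ j * mon (Y ω μ) T := by
          refine Finset.sum_congr rfl fun j hj => ?_
          rw [mon_insert _ (Finset.mem_compl.1 hj)]; ring
      _ = _ := by rw [← Finset.sum_mul, ← hd _ (hXY ω μ hμ).dual, one_mul]
  · rintro ⟨S, hS⟩
    by_cases hi : i ∈ S
    · obtain ⟨p, hp⟩ := lin_help (fun T : Finset (Fin m) => T.card + 1 = n ∧ i ∉ T) {()} (fun _ => 1)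
        (fun k => S.erase i) (fun k hk => ⟨by
          rw [Finset.card_erase_add_one hi, hS], by simp⟩)
      refine ⟨0, p, fun ω μ hμ => ?_⟩
      rw [hp (mon (Y ω μ))]
      simp only [Finset.sum_singleton]
      have e1 := (hXY ω μ hμ).comp i
      have e2 := mon_erase (Y ω μ) hi
      simp only [ww]
      rw [← e2]
      linear_combination - (mon (Y ω μ) (S.erase i)) * e1
    · obtain ⟨l, k0, hl⟩ := h.L4 S hS i
      obtain ⟨p, hp⟩ := lin_help (fun T : Finset (Fin m) => T.card + 1 = n ∧ i ∉ T) S l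
        (fun j => S.erase j) (fun j hj => ⟨by
          rw [Finset.card_erase_add_one hj, hS], by simp [hi]⟩)
      refine ⟨k0, p, fun ω μ hμ => ?_⟩
      rw [hp (mon (Y ω μ)), hl, add_mul, add_comm, Finset.sum_mul, Finset.mul_sum]
      congr 1
      refine Finset.sum_congr rfl fun j hj => ?_
      have e1 := (hXY ω μ hμ).comp j
      have e2 := mon_erase (Y ω μ) hj
      simp only [ww]
      rw [← e2]
      linear_combination - (l j * mon (Y ω μ) (S.erase j)) * e1

lemma SolS.y_ne {σ : Fin m → Bool} {A : Fin m → Fin n → ℝ} {b c μ x y} (h : SolS σ A b c μ x y)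
    (hμ : 0 < μ) (i) : y i ≠ 0 := fun h0 => by have := h.sgy hμ i; simp [h0] at this

lemma Gen.linInd (h : Gen A b c) (hmn : n ≤ m) (hXY : ∀ ω μ, 0 < μ → SolS ω.1 A b c μ (X ω μ) (Y ω μ))
    {μ : ℝ} (hμ : 0 < μ) : LinearIndependent ℝ (fun ω => ww Y ω μ) := by
  classical
  have : Fintype (Om A b c) := Fintype.ofFinite _
  refine Rep0.linInd _ ?_ ?_
  · intro ω h0
    obtain ⟨S, -, hS⟩ := Finset.exists_subset_card_eq (s := (Finset.univ : Finset (Fin m))) (n := n) (by simpa)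
    have := congrFun h0 ⟨S, hS⟩
    exact (Finset.prod_ne_zero_iff.2 fun i _ => (hXY ω μ hμ).y_ne hμ i) this
  · intro ω ω' hne
    obtain ⟨i, hi⟩ : ∃ i, ω.1 i ≠ ω'.1 i := by
      by_contra hall
      push Not at hall
      exact hne (Subtype.ext (funext hall))
    obtain ⟨F, hF, -⟩ := h.rep_y hXY i
    refine ⟨fun ω => Y ω μ i, ⟨_, fun ω => hF ω μ hμ⟩, fun he => ?_⟩
    have a1 := (hXY ω μ hμ).sgy hμ i
    have a2 := (hXY ω' μ hμ).sgy hμ i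
    simp only at he
    rw [he] at a1
    unfold sg at a1 a2
    cases h1 : ω.1 i <;> cases h2 : ω'.1 i <;> simp [h1, h2] at hi a1 a2 <;> linarith

theorem Gen.equiv (h : Gen A b c) (hmn : n ≤ m) (hXY : ∀ ω μ, 0 < μ → SolS ω.1 A b c μ (X ω μ) (Y ω μ)) :
    ∃ e : Bs m n ≃ Om A b c, ∀ μ, 0 < μ → (WM (ww Y) e μ).det ≠ 0 := by
  classical
  have : Fintype (Om A b c) := Fintype.ofFinite _
  have h1 := (h.linInd hmn hXY one_pos).fintype_card_le_finrank
  have h2 := h.card_le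
  rw [Nat.card_eq_fintype_card] at h2
  have h3 : Fintype.card (Bs m n) = Fintype.card (Om A b c) := le_antisymm h2 (by simpa using h1)
  let e := Fintype.equivOfCardEq h3
  refine ⟨e, fun μ hμ => ?_⟩
  have hl := (h.linInd hmn hXY hμ).comp e e.injective
  have : LinearIndependent ℝ (WM (ww Y) e μ).col := hl
  rw [Matrix.linearIndependent_cols_iff_isUnit, Matrix.isUnit_iff_isUnit_det] at this
  exact this.ne_zero

end CP

end

section

namespace CP

variable {m n : ℕ}

/-- the principal filter of `[1,∞)` -/
abbrev PP : Filter ℝ := 𝓟 (Set.Ici (1:ℝ))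

lemma PP_iff {f g : ℝ → ℝ} : f =O[PP] g ↔ ∃ C, ∀ μ, 1 ≤ μ → |f μ| ≤ C * |g μ| := by
  rw [Asymptotics.isBigO_principal]; simp

lemma PP_one {f : ℝ → ℝ} : f =O[PP] (fun _ => (1:ℝ)) ↔ ∃ C, ∀ μ, 1 ≤ μ → |f μ| ≤ C := by
  rw [PP_iff]; simp

lemma PP_one_id : (fun _ => (1:ℝ)) =O[PP] (fun μ : ℝ => μ) :=
  PP_iff.2 ⟨1, fun μ hμ => by rw [abs_one, one_mul]; exact hμ.trans (le_abs_self _)⟩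

variable {A : Fin m → Fin n → ℝ} {b : Fin m → ℝ} {c : Fin n → ℝ} {σ : Fin m → Bool}
  {X : ℝ → Fin n → ℝ} {Y : ℝ → Fin m → ℝ}

lemma growth_PP (hA : Inj A) (hXY : ∀ μ, 0 < μ → SolS σ A b c μ (X μ) (Y μ)) :
    ∃ C : ℝ, 0 < C ∧ ∀ μ, 1 ≤ μ →
      (∀ i, |sl A b (X μ) i| ≤ C * μ) ∧ (∀ i, |Y μ i| ≤ C * μ) ∧ (∀ j, |X μ j| ≤ C * μ) := by
  obtain ⟨C, hC, h⟩ := growth hA (hXY 1 one_pos) one_pos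
  refine ⟨2 * C, by positivity, fun μ hμ => ?_⟩
  obtain ⟨h1, h2, h3⟩ := h μ _ _ (by linarith) (hXY μ (by linarith))
  have : C * (μ + 1) ≤ 2 * C * μ := by nlinarith
  exact ⟨fun i => (h1 i).trans this, fun i => (h2 i).trans this, fun i => (h3 i).trans this⟩

lemma Gen.s_bdd (h : Gen A b c) (hmn : n ≤ m) (hXY : ∀ μ, 0 < μ → SolS σ A b c μ (X μ) (Y μ)) (η : Fin m → ℝ)
    (hη : ∀ j, ∑ i, A i j * η i = 0) (hs : ∀ i, 0 ≤ sg σ i * η i) (hne : η ≠ 0) (i : Fin m) :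
    (fun μ => sl A b (X μ) i) =O[PP] (fun _ => (1:ℝ)) := by
  classical
  set K := Finset.univ.filter (fun i => η i ≠ 0) with hK
  have hcard : n ≤ K.card := by
    by_contra hlt
    push Not at hlt
    obtain ⟨S, hKS, -, hS⟩ := Finset.exists_subsuperset_card_eq (Finset.subset_univ K) hlt.le (by simpa)
    apply hne
    have hz : ∀ k ∉ S, η k = 0 := fun k hk => by
      by_contra h0
      exact hk (hKS (by simp [hK, h0]))
    funext k
    by_cases hk : k ∈ S
    · obtain ⟨d, e, hde⟩ := h.L2 S hS k hk
      rw [hde 0 η hη, Finset.sum_eq_zero (s := Sᶜ)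
        (fun k hk => by rw [hz k (Finset.mem_compl.1 hk), mul_zero])]
      simp
    · exact hz k hk
  obtain ⟨S, hSK, hS⟩ := Finset.exists_subset_card_eq hcard
  have hb : ∀ k ∈ S, (fun μ => sl A b (X μ) k) =O[PP] (fun _ => (1:ℝ)) := by
    intro k hk
    have hk0 : η k ≠ 0 := by simpa [hK] using hSK hk
    have hk1 : 0 < |η k| := abs_pos.2 hk0
    refine PP_one.2 ⟨(- ∑ i, η i * b i) / |η k|, fun μ hμ => ?_⟩
    rw [le_div_iff₀ hk1]
    have hsol := hXY μ (by linarith)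
    have e1 : ∑ i, sl A b (X μ) i * η i = - ∑ i, η i * b i := by
      have := dual_dot (c := fun _ => 0) hη (X μ)
      simp only [zero_mul, Finset.sum_const_zero] at this
      unfold sl
      simp only [sub_mul, Finset.sum_sub_distrib]
      rw [← this, zero_sub]
      congr 1; exact Finset.sum_congr rfl fun i _ => by ring
    have e2 : ∀ i, sl A b (X μ) i * η i = |sl A b (X μ) i| * |η i| := fun i =>
      sg_mul_mul (hsol.sgn i).le (hs i)
    rw [← e1]
    simp_rw [e2]
    exact Finset.single_le_sum (f := fun i => |sl A b (X μ) i| * |η i|) (fun i _ => by positivity) (Finset.mem_univ k)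
  obtain ⟨l, k0, hl⟩ := h.L4 S hS i
  simp_rw [hl]
  refine Asymptotics.IsBigO.add (Asymptotics.IsBigO.fun_sum fun j hj => (hb j hj).const_mul_left _) ?_
  exact Asymptotics.isBigO_const_const _ one_ne_zero _

lemma Gen.y_bdd (h : Gen A b c) (hmn : n ≤ m) (hXY : ∀ μ, 0 < μ → SolS σ A b c μ (X μ) (Y μ)) (u : Fin n → ℝ)
    (hs : ∀ i, 0 ≤ sg σ i * ∑ j, A i j * u j) (hne : u ≠ 0) (i : Fin m) :
    (fun μ => Y μ i) =O[PP] (fun _ => (1:ℝ)) := by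
  classical
  set K := Finset.univ.filter (fun i => ∑ j, A i j * u j = 0) with hK
  have hcard : K.card ≤ n := by
    by_contra hlt
    push Not at hlt
    obtain ⟨S, hSK, hS⟩ := Finset.exists_subset_card_eq hlt.le
    exact hne (h.g1 S hS u fun i hi => by simpa [hK] using hSK hi)
  obtain ⟨S, hKS, -, hS⟩ := Finset.exists_subsuperset_card_eq (Finset.subset_univ K) hcard (by simpa)
  have hb : ∀ k ∉ S, (fun μ => Y μ k) =O[PP] (fun _ => (1:ℝ)) := by
    intro k hk
    have hk0 : ∑ j, A k j * u j ≠ 0 := fun h0 => hk (hKS (by simp [hK, h0]))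
    have hk1 : 0 < |∑ j, A k j * u j| := abs_pos.2 hk0
    refine PP_one.2 ⟨(∑ j, c j * u j) / |∑ j, A k j * u j|, fun μ hμ => ?_⟩
    rw [le_div_iff₀ hk1]
    have hsol := hXY μ (by linarith)
    rw [dual_dot hsol.dual u]
    have e2 : ∀ i, (∑ j, A i j * u j) * Y μ i = |Y μ i| * |∑ j, A i j * u j| := fun i => by
      rw [mul_comm]; exact sg_mul_mul (hsol.sgy (by linarith) i).le (hs i)
    simp_rw [e2]
    exact Finset.single_le_sum (f := fun i => |Y μ i| * |∑ j, A i j * u j|) (fun i _ => by positivity)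
      (Finset.mem_univ k)
  by_cases hi : i ∈ S
  · obtain ⟨d, e, hde⟩ := h.L2 S hS i hi
    have : (fun μ => ∑ j, c j * e j - ∑ k ∈ Sᶜ, d k * Y μ k) =O[PP] (fun _ => (1:ℝ)) := by
      refine Asymptotics.IsBigO.sub (Asymptotics.isBigO_const_const _ one_ne_zero _) ?_
      exact Asymptotics.IsBigO.fun_sum fun k hk => (hb k (Finset.mem_compl.1 hk)).const_mul_left _
    refine this.congr' ?_ EventuallyEq.rfl
    refine eventually_principal.2 fun μ hμ => ?_
    exact (hde c _ (hXY μ (by have : (1:ℝ) ≤ μ := hμ; linarith)).dual).symm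
  · exact hb i hi

theorem Gen.dich (h : Gen A b c) (hn : 1 ≤ n) (hmn : n ≤ m) (hXY : ∀ μ, 0 < μ → SolS σ A b c μ (X μ) (Y μ)) :
    (∀ i, (fun μ => sl A b (X μ) i) =O[PP] (fun _ => (1:ℝ))) ∨ (∀ i, (fun μ => Y μ i) =O[PP] (fun _ => (1:ℝ))) := by
  obtain ⟨C, hC, hg⟩ := growth_PP (h.inj hmn) hXY
  have hpos : ∀ k : ℕ, (1:ℝ) ≤ k + 1 := fun k => by have : (0:ℝ) ≤ k := k.cast_nonneg; linarith
  set z : ℕ → (Fin n → ℝ) × (Fin m → ℝ) := fun k => (((k:ℝ)+1)⁻¹ • X (k+1), ((k:ℝ)+1)⁻¹ • Y (k+1)) with hz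
  have hzb : ∀ k, z k ∈ Metric.closedBall (0 : (Fin n → ℝ) × (Fin m → ℝ)) C := by
    intro k
    have hp := hpos k
    obtain ⟨-, h2, h3⟩ := hg (k+1) hp
    rw [mem_closedBall_zero_iff, Prod.norm_def, max_le_iff]
    constructor
    · rw [pi_norm_le_iff_of_nonneg hC.le]
      intro j
      simp only [hz, Pi.smul_apply, smul_eq_mul, Real.norm_eq_abs, abs_mul, abs_inv]
      rw [abs_of_nonneg (by linarith : (0:ℝ) ≤ k+1), inv_mul_le_iff₀ (by linarith), mul_comm]
      exact h3 j
    · rw [pi_norm_le_iff_of_nonneg hC.le]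
      intro j
      simp only [hz, Pi.smul_apply, smul_eq_mul, Real.norm_eq_abs, abs_mul, abs_inv]
      rw [abs_of_nonneg (by linarith : (0:ℝ) ≤ k+1), inv_mul_le_iff₀ (by linarith), mul_comm]
      exact h2 j
  obtain ⟨⟨u, η⟩, -, φ, hφ, hlim⟩ := (isCompact_closedBall _ _).tendsto_subseq hzb
  have hinv : Tendsto (fun k => ((φ k : ℝ) + 1)⁻¹) atTop (𝓝 0) := by
    have := (tendsto_one_div_add_atTop_nhds_zero_nat (𝕜 := ℝ)).comp hφ.tendsto_atTop
    simpa [Function.comp_def] using this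
  have hlx : ∀ j, Tendsto (fun k => ((φ k : ℝ) + 1)⁻¹ * X (φ k + 1) j) atTop (𝓝 (u j)) := fun j => by
    have := ((continuous_apply j).comp continuous_fst).tendsto (u, η) |>.comp hlim
    simpa [hz, Function.comp_def] using this
  have hly : ∀ i, Tendsto (fun k => ((φ k : ℝ) + 1)⁻¹ * Y (φ k + 1) i) atTop (𝓝 (η i)) := fun i => by
    have := ((continuous_apply i).comp continuous_snd).tendsto (u, η) |>.comp hlim
    simpa [hz, Function.comp_def] using this
  have hls : ∀ i, Tendsto (fun k => ((φ k : ℝ) + 1)⁻¹ * sl A b (X (φ k + 1)) i) atTop (𝓝 (∑ j, A i j * u j)) := by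
    intro i
    have h1 : Tendsto (fun k => ∑ j, A i j * (((φ k : ℝ) + 1)⁻¹ * X (φ k + 1) j) - ((φ k : ℝ) + 1)⁻¹ * b i) atTop
        (𝓝 (∑ j, A i j * u j - 0 * b i)) :=
      (tendsto_finsetSum _ fun j _ => (hlx j).const_mul _).sub (hinv.mul_const _)
    rw [zero_mul, sub_zero] at h1
    refine h1.congr fun k => ?_
    unfold sl
    rw [mul_sub, Finset.mul_sum]
    congr 1
    exact Finset.sum_congr rfl fun j _ => by ring
  have hinvp : ∀ k : ℕ, 0 < ((k:ℝ)+1)⁻¹ := fun k => by have := hpos k; positivity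
  have hsx : ∀ i, 0 ≤ sg σ i * ∑ j, A i j * u j := fun i => by
    refine ge_of_tendsto ((hls i).const_mul (sg σ i)) (Eventually.of_forall fun k => ?_)
    have := (hXY (φ k + 1) (by have := hpos (φ k); linarith)).sgn i
    have := mul_pos (hinvp (φ k)) this
    linarith
  have hsy : ∀ i, 0 ≤ sg σ i * η i := fun i => by
    refine ge_of_tendsto ((hly i).const_mul (sg σ i)) (Eventually.of_forall fun k => ?_)
    have hp : (0:ℝ) < φ k + 1 := by have := hpos (φ k); linarith
    have := (hXY (φ k + 1) hp).sgy hp i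
    have := mul_pos (hinvp (φ k)) this
    linarith
  have hd : ∀ j, ∑ i, A i j * η i = 0 := by
    intro j
    have h1 : Tendsto (fun k => ∑ i, A i j * (((φ k : ℝ) + 1)⁻¹ * Y (φ k + 1) i)) atTop (𝓝 (∑ i, A i j * η i)) :=
      tendsto_finsetSum _ fun i _ => (hly i).const_mul _
    have h2 : Tendsto (fun k => ((φ k : ℝ) + 1)⁻¹ * c j) atTop (𝓝 (0 * c j)) := hinv.mul_const _
    rw [zero_mul] at h2
    refine tendsto_nhds_unique h1 (h2.congr fun k => ?_)
    rw [← (hXY (φ k + 1) (by have := hpos (φ k); linarith)).dual j, Finset.mul_sum]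
    exact Finset.sum_congr rfl fun i _ => by ring
  by_cases hη : η = 0
  · right
    refine fun i => h.y_bdd hmn hXY u hsx ?_ i
    rintro rfl
    have h0 := hXY 1 one_pos
    have h1 : Tendsto (fun k => ∑ i, ((((φ k : ℝ) + 1)⁻¹ * sl A b (X (φ k + 1)) i) * Y 1 i
        + sl A b (X 1) i * (((φ k : ℝ) + 1)⁻¹ * Y (φ k + 1) i))) atTop
        (𝓝 (∑ i, ((∑ j, A i j * (0 : Fin n → ℝ) j) * Y 1 i + sl A b (X 1) i * η i))) :=
      tendsto_finsetSum _ fun i _ => ((hls i).mul_const _).add ((hly i).const_mul _)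
    have h3 : ∀ k, (m:ℝ) ≤ ∑ i, ((((φ k : ℝ) + 1)⁻¹ * sl A b (X (φ k + 1)) i) * Y 1 i
        + sl A b (X 1) i * (((φ k : ℝ) + 1)⁻¹ * Y (φ k + 1) i)) := by
      intro k
      have hp := hpos (φ k)
      have hc := cross (hXY (φ k + 1) (by linarith)).toIsSol h0.toIsSol
      have : ∑ i, ((((φ k : ℝ) + 1)⁻¹ * sl A b (X (φ k + 1)) i) * Y 1 i
        + sl A b (X 1) i * (((φ k : ℝ) + 1)⁻¹ * Y (φ k + 1) i)) = ((φ k : ℝ) + 1)⁻¹ * (m * (φ k + 1 + 1)) := by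
        rw [← hc, Finset.mul_sum]
        exact Finset.sum_congr rfl fun i _ => by ring
      rw [this, le_inv_mul_iff₀ (by linarith)]
      have : (0:ℝ) ≤ m := m.cast_nonneg
      nlinarith
    have h4 := ge_of_tendsto h1 (Eventually.of_forall h3)
    simp [hη] at h4
    have : (1:ℝ) ≤ m := by exact_mod_cast hn.trans hmn
    have : (m:ℝ) = 0 := by exact_mod_cast h4
    linarith
  · left
    exact fun i => h.s_bdd hmn hXY η hd hsy hη i

end CP

end

section

namespace CP

variable {m n : ℕ}

/-- the linearized system -/
def MM (A : Fin m → Fin n → ℝ) (s y : Fin m → ℝ) : Matrix (Fin n ⊕ Fin m) (Fin n ⊕ Fin m) ℝ :=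
  Matrix.fromBlocks 0 (Matrix.of fun j i => A i j) (Matrix.of fun i j => y i * A i j) (Matrix.diagonal s)

def eR : Fin n ⊕ Fin m → ℝ := Sum.elim (fun _ => 0) (fun _ => 1)

/-- bordered matrix -/
def BB (A : Fin m → Fin n → ℝ) (s y : Fin m → ℝ) (v : Fin n ⊕ Fin m → ℝ) :
    Matrix ((Fin n ⊕ Fin m) ⊕ Unit) ((Fin n ⊕ Fin m) ⊕ Unit) ℝ :=
  Matrix.fromBlocks (MM A s y) (Matrix.replicateCol Unit eR) (Matrix.replicateRow Unit v) 0

def NN (A : Fin m → Fin n → ℝ) (s y : Fin m → ℝ) (v : Fin n ⊕ Fin m → ℝ) : ℝ := (BB A s y v).det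

lemma NN_eq (A : Fin m → Fin n → ℝ) (s y : Fin m → ℝ) (v z : Fin n ⊕ Fin m → ℝ) (hz : MM A s y *ᵥ z = eR) :
    NN A s y v = - ((MM A s y).det * (v ⬝ᵥ z)) := by
  have h : BB A s y v = Matrix.fromBlocks (MM A s y) 0 (Matrix.replicateRow Unit v)
      (Matrix.of fun _ _ => - (v ⬝ᵥ z)) * Matrix.fromBlocks 1 (Matrix.replicateCol Unit z) 0 1 := by
    rw [Matrix.fromBlocks_multiply, BB]
    congr 1
    · simp
    · rw [← hz, Matrix.replicateCol_mulVec]; simp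
    · simp
    · ext i j
      simp [Matrix.mul_apply, dotProduct]
  rw [NN, h, Matrix.det_mul, Matrix.det_fromBlocks_zero₁₂, Matrix.det_fromBlocks_zero₂₁]
  simp

lemma det_bigO {κ : Type*} [Fintype κ] [DecidableEq κ] (M : ℝ → Matrix κ κ ℝ) (g h : κ → ℝ → ℝ)
    (hM : ∀ a b, (fun μ => M μ a b) =O[PP] fun μ => g a μ * h b μ) :
    (fun μ => (M μ).det) =O[PP] fun μ => (∏ a, g a μ) * ∏ b, h b μ := by
  simp_rw [Matrix.det_apply']
  refine Asymptotics.IsBigO.fun_sum fun τ _ => Asymptotics.IsBigO.const_mul_left ?_ _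
  have := Asymptotics.IsBigO.finsetProd (l := PP) (s := Finset.univ) (f := fun i μ => M μ (τ i) i)
    (g := fun i μ => g (τ i) μ * h i μ) (fun i _ => hM _ _)
  refine this.congr_right fun μ => ?_
  rw [Finset.prod_mul_distrib, Equiv.prod_comp τ (fun a => g a μ)]

variable {A : Fin m → Fin n → ℝ} {b : Fin m → ℝ} {c : Fin n → ℝ}

lemma N_s {s y : ℝ → Fin m → ℝ} (hs : ∀ i, (fun μ => s μ i) =O[PP] (fun _ => (1:ℝ)))
    (hy : ∀ i, (fun μ => y μ i) =O[PP] (fun μ => μ)) (v) :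
    (fun μ => NN A (s μ) (y μ) v) =O[PP] (fun μ => μ ^ n) := by
  have := det_bigO (fun μ => BB A (s μ) (y μ) v) (fun _ _ => 1)
    (Sum.elim (Sum.elim (fun _ μ => μ) (fun _ _ => 1)) (fun _ _ => 1)) ?_
  · refine this.congr_right fun μ => ?_
    simp
  · have hc : ∀ r : ℝ, (fun _ : ℝ => r) =O[PP] (fun _ => (1:ℝ)) :=
      fun r => Asymptotics.isBigO_const_const _ one_ne_zero _
    have hc' : ∀ r : ℝ, (fun _ : ℝ => r) =O[PP] (fun μ => μ) := fun r => (hc r).trans PP_one_id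
    rintro ((j | i) | u) ((j' | i') | u') <;> simp only [BB, MM, Matrix.fromBlocks_apply₁₁, Matrix.fromBlocks_apply₁₂,
      Matrix.fromBlocks_apply₂₁, Matrix.fromBlocks_apply₂₂, Matrix.of_apply, Matrix.zero_apply, Matrix.diagonal_apply,
      Matrix.replicateCol_apply, Matrix.replicateRow_apply, Sum.elim_inl, Sum.elim_inr, one_mul]
    · exact hc' _
    · exact hc _
    · exact hc _
    · simp_rw [mul_comm]
      exact (hy i).const_mul_left _
    · split_ifs
      · exact hs i
      · exact hc _
    · exact hc _
    · exact hc' _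
    · exact hc _
    · exact hc _

lemma N_y (hmn : n ≤ m) {s y : ℝ → Fin m → ℝ} (hy : ∀ i, (fun μ => y μ i) =O[PP] (fun _ => (1:ℝ)))
    (hs : ∀ i, (fun μ => s μ i) =O[PP] (fun μ => μ)) (v) :
    (fun μ => NN A (s μ) (y μ) v) =O[PP] (fun μ => μ ^ (m - n)) := by
  have := det_bigO (fun μ => BB A (s μ) (y μ) v) (Sum.elim (Sum.elim (fun _ μ => μ⁻¹) (fun _ _ => 1)) (fun _ _ => 1))
    (Sum.elim (Sum.elim (fun _ _ => 1) (fun _ μ => μ)) (fun _ _ => 1)) ?_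
  · refine this.congr' EventuallyEq.rfl (eventually_principal.2 fun μ hμ => ?_)
    have hμ : μ ≠ 0 := by have : (1:ℝ) ≤ μ := hμ; positivity
    simp
    rw [pow_sub₀ _ hμ hmn, mul_comm]
  · have hc : ∀ r : ℝ, (fun _ : ℝ => r) =O[PP] (fun _ => (1:ℝ)) :=
      fun r => Asymptotics.isBigO_const_const _ one_ne_zero _
    have hc' : ∀ r : ℝ, (fun _ : ℝ => r) =O[PP] (fun μ => μ) := fun r => (hc r).trans PP_one_id
    have hz : ∀ g : ℝ → ℝ, (fun _ : ℝ => (0:ℝ)) =O[PP] g := fun g => Asymptotics.isBigO_zero _ _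
    rintro ((j | i) | u) ((j' | i') | u') <;> simp only [BB, MM, eR, Matrix.fromBlocks_apply₁₁, Matrix.fromBlocks_apply₁₂,
      Matrix.fromBlocks_apply₂₁, Matrix.fromBlocks_apply₂₂, Matrix.of_apply, Matrix.zero_apply, Matrix.diagonal_apply,
      Matrix.replicateCol_apply, Matrix.replicateRow_apply, Sum.elim_inl, Sum.elim_inr, one_mul, mul_one]
    · exact hz _
    · refine (hc _).congr' EventuallyEq.rfl (eventually_principal.2 fun μ hμ => ?_)
      have hμ : μ ≠ 0 := by have : (1:ℝ) ≤ μ := hμ; positivity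
      simp [hμ]
    · exact hz _
    · simp_rw [mul_comm]
      exact (hy i).const_mul_left _
    · split_ifs
      · exact hs i
      · exact hc' _
    · exact hc _
    · exact hc _
    · exact hc' _
    · exact hc _

variable {X : Om A b c → ℝ → Fin n → ℝ} {Y : Om A b c → ℝ → Fin m → ℝ}

lemma Gen.rep_N (h : Gen A b c) (hmn : n ≤ m) (hXY : ∀ ω μ, 0 < μ → SolS ω.1 A b c μ (X ω μ) (Y ω μ)) (v) :
    Rep (ww Y) (fun ω μ => NN A (sl A b (X ω μ)) (Y ω μ) v) := by
  have := Rep.det (w := ww Y) (fun a b' ω μ => BB A (sl A b (X ω μ)) (Y ω μ) v a b') ?_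
  · exact this
  · have hy : ∀ i, Rep (ww Y) (fun ω μ => Y ω μ i) := fun i => by
      obtain ⟨F, hF, -⟩ := h.rep_y hXY i; exact ⟨F, hF⟩
    have hs : ∀ i, Rep (ww Y) (fun ω μ => sl A b (X ω μ) i) := fun i => by
      obtain ⟨F, hF, -⟩ := h.rep_s hmn hXY i; exact ⟨F, hF⟩
    rintro ((j | i) | u) ((j' | i') | u') <;> simp only [BB, MM, Matrix.fromBlocks_apply₁₁, Matrix.fromBlocks_apply₁₂,
      Matrix.fromBlocks_apply₂₁, Matrix.fromBlocks_apply₂₂, Matrix.of_apply, Matrix.zero_apply, Matrix.diagonal_apply,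
      Matrix.replicateCol_apply, Matrix.replicateRow_apply, Sum.elim_inl, Sum.elim_inr]
    · exact Rep.const _
    · exact Rep.const _
    · exact Rep.const _
    · exact (hy i).mul (Rep.const _)
    · split_ifs
      · exact hs i
      · exact Rep.const _
    · exact Rep.const _
    · exact Rep.const _
    · exact Rep.const _
    · exact Rep.const _

lemma prod_lower {Ω : Type*} [Fintype Ω] [DecidableEq Ω] (B : Finset Ω) (f : Ω → ℝ → ℝ)
    (h1 : ∀ ω ∈ B, ∃ C, 0 < C ∧ ∀ μ, 1 ≤ μ → C * μ ≤ |f ω μ|)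
    (h2 : ∀ ω ∉ B, ∃ C, 0 < C ∧ ∀ μ, 1 ≤ μ → C ≤ |f ω μ|) :
    ∃ C, 0 < C ∧ ∀ μ : ℝ, 1 ≤ μ → C * μ ^ B.card ≤ |∏ ω, f ω μ| := by
  have : ∀ ω, ∃ C, 0 < C ∧ ∀ μ : ℝ, 1 ≤ μ → C * (if ω ∈ B then μ else 1) ≤ |f ω μ| := by
    intro ω
    by_cases h : ω ∈ B
    · simpa [h] using h1 ω h
    · simpa [h] using h2 ω h
  choose C hC h using this
  refine ⟨∏ ω, C ω, Finset.prod_pos fun ω _ => hC ω, fun μ hμ => ?_⟩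
  have e : μ ^ B.card = ∏ ω, (if ω ∈ B then μ else 1) := by simp [Finset.prod_ite_mem]
  rw [e, ← Finset.prod_mul_distrib, Finset.abs_prod]
  refine Finset.prod_le_prod (fun ω _ => ?_) fun ω _ => h ω μ hμ
  have := hC ω
  split_ifs <;> positivity

lemma lower_aux {f g : ℝ → ℝ} {r : ℝ → ℝ} (hfg : ∀ μ, 1 ≤ μ → f μ * g μ = μ) (hr : ∀ μ, 1 ≤ μ → 0 < r μ)
    (hf : f =O[PP] r) : ∃ C, 0 < C ∧ ∀ μ, 1 ≤ μ → C * (μ / r μ) ≤ |g μ| := by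
  obtain ⟨C, hC⟩ := PP_iff.1 hf
  refine ⟨(|C| + 1)⁻¹, by positivity, fun μ hμ => ?_⟩
  have h1 := hC μ hμ
  have h2 := hr μ hμ
  rw [abs_of_pos h2] at h1
  have h3 : |f μ| * |g μ| = μ := by rw [← abs_mul, hfg μ hμ, abs_of_pos (by linarith)]
  rw [inv_mul_le_iff₀ (by positivity), div_le_iff₀ h2]
  calc μ = |f μ| * |g μ| := h3.symm
    _ ≤ ((|C| + 1) * r μ) * |g μ| := by
        gcongr
        refine h1.trans ?_
        gcongr
        linarith [le_abs_self C]
    _ = _ := by ring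

theorem Gen.count (h : Gen A b c) (hn : 1 ≤ n) (hmn : n < m)
    (hXY : ∀ ω μ, 0 < μ → SolS ω.1 A b c μ (X ω μ) (Y ω μ)) (v)
    (hne : ∀ ω, NN A (sl A b (X ω 1)) (Y ω 1) v ≠ 0) (Z : Finset (Om A b c × ℝ))
    (hZ : ∀ z ∈ Z, 0 < z.2 ∧ NN A (sl A b (X z.1 z.2)) (Y z.1 z.2) v = 0) :
    Z.card ≤ 2 * (n * (m - 1).choose n) := by
  classical
  have : Fintype (Om A b c) := Fintype.ofFinite _
  obtain ⟨e, he⟩ := h.equiv hmn.le hXY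
  have hinj := h.inj hmn.le
  set B : Finset (Om A b c) := Finset.univ.filter
    (fun ω => ∀ i, (fun μ => sl A b (X ω μ) i) =O[PP] (fun _ => (1:ℝ))) with hB
  have hBs : ∀ ω ∈ B, ∀ i, (fun μ => sl A b (X ω μ) i) =O[PP] (fun _ => (1:ℝ)) := fun ω hω => by
    simpa [hB] using hω
  have hBy : ∀ ω ∉ B, ∀ i, (fun μ => Y ω μ i) =O[PP] (fun _ => (1:ℝ)) := fun ω hω =>
    (h.dich hn hmn.le (hXY ω)).resolve_left (by simpa [hB] using hω)
  have hgs : ∀ ω i, (fun μ => sl A b (X ω μ) i) =O[PP] (fun μ => μ) := fun ω i => by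
    obtain ⟨C, -, hC⟩ := growth_PP hinj (hXY ω)
    exact PP_iff.2 ⟨C, fun μ hμ => by rw [abs_of_nonneg (by linarith : 0 ≤ μ)]; exact (hC μ hμ).1 i⟩
  have hgy : ∀ ω i, (fun μ => Y ω μ i) =O[PP] (fun μ => μ) := fun ω i => by
    obtain ⟨C, -, hC⟩ := growth_PP hinj (hXY ω)
    exact PP_iff.2 ⟨C, fun μ hμ => by rw [abs_of_nonneg (by linarith : 0 ≤ μ)]; exact (hC μ hμ).2.1 i⟩
  have hcomp : ∀ ω i μ, 1 ≤ μ → sl A b (X ω μ) i * Y ω μ i = μ := fun ω i μ hμ => (hXY ω μ (by linarith)).comp i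
  have hcomp' : ∀ ω i μ, 1 ≤ μ → Y ω μ i * sl A b (X ω μ) i = μ := fun ω i μ hμ => by
    rw [mul_comm]; exact hcomp ω i μ hμ
  have hm : 0 < m := by omega
  let i0 : Fin m := ⟨0, hm⟩
  have hcB : B.card ≤ (m - 1).choose n := by
    obtain ⟨F, hF, hd⟩ := h.rep_y hXY i0
    refine le_trans ?_ hd
    obtain ⟨C, hC, hle⟩ := prod_lower B (fun ω μ => Y ω μ i0) (fun ω hω => by
        obtain ⟨C, hC, h⟩ := lower_aux (hcomp ω i0) (fun _ _ => one_pos) (hBs ω hω i0)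
        exact ⟨C, hC, by simpa using h⟩) (fun ω hω => by
        obtain ⟨C, hC, h⟩ := lower_aux (hcomp ω i0) (fun μ hμ => by linarith) (hgs ω i0)
        refine ⟨C, hC, fun μ hμ => ?_⟩
        have := h μ hμ
        rwa [div_self (by positivity), mul_one] at this)
    refine le_poly_deg _ C hC _ fun μ hμ => ?_
    rw [hF.det_eval e (by linarith) (he μ (by linarith))]
    exact hle μ hμ
  have hcU : Bᶜ.card ≤ (m - 1).choose (n - 1) := by
    obtain ⟨F, hF, hd⟩ := h.rep_s hmn.le hXY i0
    refine le_trans ?_ hd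
    obtain ⟨C, hC, hle⟩ := prod_lower Bᶜ (fun ω μ => sl A b (X ω μ) i0) (fun ω hω => by
        obtain ⟨C, hC, h⟩ := lower_aux (hcomp' ω i0) (fun _ _ => one_pos) (hBy ω (Finset.mem_compl.1 hω) i0)
        exact ⟨C, hC, by simpa using h⟩) (fun ω hω => by
        obtain ⟨C, hC, h⟩ := lower_aux (hcomp' ω i0) (fun μ hμ => by linarith) (hgy ω i0)
        refine ⟨C, hC, fun μ hμ => ?_⟩
        have := h μ hμ
        rwa [div_self (by positivity), mul_one] at this)
    refine le_poly_deg _ C hC _ fun μ hμ => ?_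
    rw [hF.det_eval e (by linarith) (he μ (by linarith))]
    exact hle μ hμ
  obtain ⟨F, hF⟩ := h.rep_N hmn.le hXY v
  have hF0 : F.det ≠ 0 := by
    intro h0
    have := hF.det_eval e one_pos (he 1 one_pos)
    rw [h0, Polynomial.eval_zero] at this
    exact (Finset.prod_ne_zero_iff.2 fun ω _ => hne ω) this.symm
  refine (hF.count e he hF0 Z hZ).trans ?_
  have hdeg : F.det.natDegree ≤ ∑ ω, (if ω ∈ B then n else m - n) := by
    have hO : (fun μ => ∏ ω, NN A (sl A b (X ω μ)) (Y ω μ) v) =O[PP]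
        fun μ => ∏ ω, μ ^ (if ω ∈ B then n else m - n) := by
      refine Asymptotics.IsBigO.finsetProd fun ω _ => ?_
      by_cases hω : ω ∈ B
      · simp only [hω, if_true]
        exact N_s (hBs ω hω) (hgy ω) v
      · simp only [hω, if_false]
        exact N_y hmn.le (hBy ω hω) (hgs ω) v
    obtain ⟨C, hC⟩ := PP_iff.1 hO
    refine poly_deg_le _ C _ fun μ hμ => ?_
    rw [hF.det_eval e (by linarith) (he μ (by linarith))]
    refine (hC μ hμ).trans (le_of_eq ?_)
    rw [Finset.prod_pow_eq_pow_sum, abs_of_nonneg (by positivity)]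
  refine hdeg.trans ?_
  have hsum : ∑ ω, (if ω ∈ B then n else m - n) = B.card * n + Bᶜ.card * (m - n) := by
    rw [← Finset.sum_add_sum_compl B]
    rw [Finset.sum_congr rfl (fun ω hω => if_pos hω),
      Finset.sum_congr (s₁ := Bᶜ) rfl (fun ω hω => if_neg (Finset.mem_compl.1 hω))]
    simp
  have hch : (m - 1).choose n * n = (m - 1).choose (n - 1) * (m - n) := by
    have := Nat.choose_succ_right_eq (m - 1) (n - 1)
    rw [Nat.sub_add_cancel hn] at this
    rw [this]; congr 1; omega
  rw [hsum]
  calc B.card * n + Bᶜ.card * (m - n) ≤ (m - 1).choose n * n + (m - 1).choose (n - 1) * (m - n) := by gcongr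
    _ = _ := by rw [← hch]; ring

end CP

end

section

namespace CP

variable {m n : ℕ}

open Polynomial in
lemma line_det {κ : Type*} [Fintype κ] [DecidableEq κ] (M0 M1 : Matrix κ κ ℝ) (h : M1.det ≠ 0) :
    ∀ᶠ t in 𝓝[≠] (0:ℝ), ((1 - t) • M0 + t • M1).det ≠ 0 := by
  set p : ℝ[X] := ((1 - X : ℝ[X]) • M0.map C + (X : ℝ[X]) • M1.map C).det with hp
  have hev : ∀ t, p.eval t = ((1 - t) • M0 + t • M1).det := by
    intro t
    rw [hp, ← coe_evalRingHom, RingHom.map_det]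
    congr 1
    ext i j
    simp
    ring
  have hp0 : p ≠ 0 := by
    intro h0
    have := hev 1
    rw [h0] at this
    simp at this
    exact h this.symm
  have hfin : ({t | p.IsRoot t} \ {0} : Set ℝ).Finite := (finite_setOf_isRoot hp0).subset Set.diff_subset
  have hmem : ({t | p.IsRoot t} \ {0} : Set ℝ)ᶜ ∈ 𝓝 (0:ℝ) := hfin.isClosed.isOpen_compl.mem_nhds (by simp)
  filter_upwards [nhdsWithin_le_nhds hmem, self_mem_nhdsWithin] with t ht ht0
  rw [← hev]
  intro hr
  exact ht ⟨hr, ht0⟩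

lemma gen_line (A : Fin m → Fin n → ℝ) (b : Fin m → ℝ) (c : Fin n → ℝ) :
    ∀ᶠ t in 𝓝[≠] (0:ℝ), Gen (fun i j => (1 - t) * A i j + t * ((i:ℕ):ℝ) ^ (j:ℕ))
      (fun i => (1 - t) * b i + t * ((i:ℕ):ℝ) ^ n) (fun j => (1 - t) * c j + t * (-1) ^ (j:ℕ)) := by
  have hinj : Function.Injective (fun i : Fin m => ((i:ℕ):ℝ)) := fun i j h => by
    have h : ((i:ℕ):ℝ) = ((j:ℕ):ℝ) := h
    have : (i:ℕ) = j := by exact_mod_cast h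
    exact Fin.ext this
  have e1 : ∀ᶠ t in 𝓝[≠] (0:ℝ), ∀ S : Finset (Fin m), S.card = n → ∀ u : Fin n → ℝ,
      (∀ i ∈ S, ∑ j : Fin n, ((1 - t) * A i j + t * ((i:ℕ):ℝ) ^ (j:ℕ)) * u j = 0) → u = 0 := by
    rw [eventually_all]
    intro S
    rw [eventually_imp_distrib_left]
    intro hS
    let f := S.orderEmbOfFin hS
    filter_upwards [line_det (Matrix.of fun r j => A (f r) j) (Matrix.vandermonde fun r => ((f r : ℕ) : ℝ))
      (Matrix.det_vandermonde_ne_zero_iff.2 (hinj.comp f.injective))] with t ht u hu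
    refine Matrix.eq_zero_of_mulVec_eq_zero ht ?_
    funext r
    rw [Pi.zero_apply, ← hu (f r) (Finset.orderEmbOfFin_mem _ _ _)]
    simp [Matrix.mulVec, dotProduct, Matrix.vandermonde_apply]
  have e2 : ∀ᶠ t in 𝓝[≠] (0:ℝ), ∀ T : Finset (Fin m), T.card = n + 1 → ∀ x : Fin n → ℝ, ∃ i ∈ T,
      sl (fun i (j : Fin n) => (1 - t) * A i j + t * ((i:ℕ):ℝ) ^ (j:ℕ)) (fun i => (1 - t) * b i + t * ((i:ℕ):ℝ) ^ n) x i ≠ 0 := by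
    rw [eventually_all]
    intro S
    rw [eventually_imp_distrib_left]
    intro hS
    let f := S.orderEmbOfFin hS
    filter_upwards [line_det (Matrix.of fun r j => (Fin.snoc (A (f r)) (b (f r)) : Fin (n+1) → ℝ) j)
      (Matrix.vandermonde fun r => ((f r : ℕ) : ℝ))
      (Matrix.det_vandermonde_ne_zero_iff.2 (hinj.comp f.injective))] with t ht x
    by_contra hall
    push Not at hall
    have := Matrix.eq_zero_of_mulVec_eq_zero ht (v := Fin.snoc (α := fun _ => ℝ) x (-1)) ?_
    · have := congrFun this (Fin.last n)
      simp at this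
    · funext r
      rw [Pi.zero_apply, ← hall (f r) (Finset.orderEmbOfFin_mem _ _ _)]
      simp [Matrix.mulVec, dotProduct, Matrix.vandermonde_apply, Fin.sum_univ_castSucc, sl]
      ring
  have e3 : ∀ᶠ t in 𝓝[≠] (0:ℝ), ∀ T : Finset (Fin m), T.card + 1 = n → ∀ u : Fin n → ℝ,
      (∀ i ∈ T, ∑ j : Fin n, ((1 - t) * A i j + t * ((i:ℕ):ℝ) ^ (j:ℕ)) * u j = 0) →
      ∑ j : Fin n, ((1 - t) * c j + t * (-1) ^ (j:ℕ)) * u j = 0 → u = 0 := by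
    rw [eventually_all]
    intro S
    rw [eventually_imp_distrib_left]
    intro hS
    subst hS
    let f := S.orderEmbOfFin rfl
    have hi2 : Function.Injective (Fin.cons (-1) (fun r => ((f r : ℕ) : ℝ)) : Fin (S.card + 1) → ℝ) := by
      rw [Fin.cons_injective_iff]
      refine ⟨?_, hinj.comp f.injective⟩
      rintro ⟨r, hr⟩
      have : (0:ℝ) ≤ ((f r : ℕ) : ℝ) := Nat.cast_nonneg _
      simp only at hr
      linarith
    filter_upwards [line_det (Matrix.of (Fin.cons c (fun r => A (f r)) : Fin (S.card+1) → Fin (S.card + 1) → ℝ))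
      (Matrix.vandermonde (Fin.cons (-1) (fun r => ((f r : ℕ) : ℝ))))
      (Matrix.det_vandermonde_ne_zero_iff.2 hi2)] with t ht u hu hc
    refine Matrix.eq_zero_of_mulVec_eq_zero ht ?_
    funext r
    refine Fin.cases ?_ (fun r => ?_) r
    · rw [Pi.zero_apply, ← hc]
      simp only [Matrix.mulVec, dotProduct, Matrix.add_apply, Matrix.smul_apply, Matrix.of_apply, Matrix.vandermonde_apply, Fin.cons_zero, Fin.cons_succ, smul_eq_mul]
    · rw [Pi.zero_apply, ← hu (f r) (Finset.orderEmbOfFin_mem _ _ _)]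
      simp only [Matrix.mulVec, dotProduct, Matrix.add_apply, Matrix.smul_apply, Matrix.of_apply, Matrix.vandermonde_apply, Fin.cons_zero, Fin.cons_succ, smul_eq_mul]
  filter_upwards [e1, e2, e3] with t h1 h2 h3
  exact ⟨h1, h2, h3⟩

theorem gen_approx (A : Fin m → Fin n → ℝ) (b : Fin m → ℝ) (c : Fin n → ℝ) :
    ∃ q : ℕ → (Fin m → Fin n → ℝ) × (Fin m → ℝ) × (Fin n → ℝ),
      Tendsto q atTop (𝓝 (A, b, c)) ∧ ∀ k, Gen (q k).1 (q k).2.1 (q k).2.2 := by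
  obtain ⟨t, ht⟩ := Filter.exists_seq_tendsto (𝓝[≠] (0:ℝ))
  obtain ⟨N, hN⟩ := eventually_atTop.1 (ht.eventually (gen_line A b c))
  let Q : ℝ → (Fin m → Fin n → ℝ) × (Fin m → ℝ) × (Fin n → ℝ) := fun t =>
    (fun i j => (1 - t) * A i j + t * ((i:ℕ):ℝ) ^ (j:ℕ), fun i => (1 - t) * b i + t * ((i:ℕ):ℝ) ^ n,
      fun j => (1 - t) * c j + t * (-1) ^ (j:ℕ))
  have hQ : Continuous Q := by
    refine Continuous.prodMk ?_ (Continuous.prodMk ?_ ?_)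
    · exact continuous_pi fun i => continuous_pi fun j => by fun_prop
    · exact continuous_pi fun i => by fun_prop
    · exact continuous_pi fun i => by fun_prop
  have hQ0 : Q 0 = (A, b, c) := by simp [Q]
  refine ⟨fun k => Q (t (k + N)), ?_, fun k => hN _ (by omega)⟩
  rw [← hQ0]
  exact (hQ.tendsto 0).comp ((ht.mono_right nhdsWithin_le_nhds).comp (tendsto_add_atTop_nat N))

end CP

end

section

namespace CP

variable {m n : ℕ}

lemma continuous_MM : Continuous fun p : (Fin m → Fin n → ℝ) × (Fin m → ℝ) × (Fin m → ℝ) => MM p.1 p.2.1 p.2.2 := by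
  unfold MM
  refine Continuous.matrix_fromBlocks continuous_const ?_ ?_ ?_
  · exact continuous_matrix fun i j => by simp only [Matrix.of_apply]; fun_prop
  · exact continuous_matrix fun i j => by simp only [Matrix.of_apply]; fun_prop
  · exact Continuous.matrix_diagonal (by fun_prop)

lemma continuous_NN : Continuous fun p : ((Fin m → Fin n → ℝ) × (Fin m → ℝ) × (Fin m → ℝ)) × (Fin n ⊕ Fin m → ℝ) =>
    NN p.1.1 p.1.2.1 p.1.2.2 p.2 := by
  unfold NN BB
  refine Continuous.matrix_det (Continuous.matrix_fromBlocks (continuous_MM.comp continuous_fst) continuous_const ?_ continuous_const)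
  exact continuous_matrix fun i j => by simp only [Matrix.replicateRow_apply]; fun_prop

/-- ratio -/
noncomputable def RR (A : Fin m → Fin n → ℝ) (s y : Fin m → ℝ) (w : Fin n ⊕ Fin m → ℝ) : ℝ :=
  NN A s y w / (MM A s y).det

lemma SolS.det_ne {σ : Fin m → Bool} {A : Fin m → Fin n → ℝ} {b c μ x y} (h : SolS σ A b c μ x y)
    (hA : Inj A) (hμ : 0 < μ) : (MM A (sl A b x) y).det ≠ 0 := by
  intro h0
  obtain ⟨v, hv, hv0⟩ := Matrix.exists_mulVec_eq_zero_iff.2 h0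
  have hnd := h.nondeg hA hμ (fun j => v (Sum.inl j)) (fun i => v (Sum.inr i)) ?_ ?_
  · apply hv
    funext t
    rcases t with j | i
    · exact congrFun hnd.1 j
    · exact congrFun hnd.2 i
  · intro i
    have := congrFun hv0 (Sum.inr i)
    simp only [MM, Matrix.mulVec, dotProduct, Fintype.sum_sum_type, Matrix.fromBlocks_apply₂₁, Matrix.of_apply,
      Matrix.fromBlocks_apply₂₂, Pi.zero_apply, Matrix.diagonal_apply, ite_mul, zero_mul, Finset.sum_ite_eq, Finset.mem_univ, if_true] at this
    rw [← this, Finset.sum_mul]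
    congr 1
    exact Finset.sum_congr rfl fun j _ => by ring
  · intro j
    have := congrFun hv0 (Sum.inl j)
    simpa [MM, Matrix.mulVec, dotProduct, Fintype.sum_sum_type] using this

lemma tendsto_RR {α : Type*} {l : Filter α} {A : α → Fin m → Fin n → ℝ} {s y : α → Fin m → ℝ} {w : α → Fin n ⊕ Fin m → ℝ}
    {A0 s0 y0 w0} (hA : Tendsto A l (𝓝 A0)) (hs : Tendsto s l (𝓝 s0)) (hy : Tendsto y l (𝓝 y0)) (hw : Tendsto w l (𝓝 w0))
    (hd : (MM A0 s0 y0).det ≠ 0) :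
    Tendsto (fun t => RR (A t) (s t) (y t) (w t)) l (𝓝 (RR A0 s0 y0 w0)) := by
  have h3 := hA.prodMk_nhds (hs.prodMk_nhds hy)
  have h4 := (continuous_NN.tendsto ((A0, s0, y0), w0)).comp (h3.prodMk_nhds hw)
  have h5 := ((Continuous.matrix_det continuous_MM).tendsto (A0, s0, y0)).comp h3
  exact Tendsto.div h4 h5 hd

lemma SolS.RR_persist {σ : Fin m → Bool} {q : Par m n} {x y}
    (h : SolS σ q.1 q.2.1 q.2.2.1 q.2.2.2 x y) (hA : Inj q.1) (hμ : 0 < q.2.2.2) (w : Fin n ⊕ Fin m → ℝ) :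
    ∃ f : Par m n × (Fin n ⊕ Fin m → ℝ) → ℝ, Tendsto f (𝓝 (q, w)) (𝓝 (RR q.1 (sl q.1 q.2.1 x) y w)) ∧
      ∀ᶠ p in 𝓝 (q, w), ∃ x' y', SolS σ p.1.1 p.1.2.1 p.1.2.2.1 p.1.2.2.2 x' y' ∧
        f p = RR p.1.1 (sl p.1.1 p.1.2.1 x') y' p.2 := by
  obtain ⟨φ, hφ, hs⟩ := h.persist hA hμ
  refine ⟨fun p => RR p.1.1 (sl p.1.1 p.1.2.1 (φ p.1).1) (φ p.1).2 p.2, ?_, ?_⟩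
  · have h1 : Tendsto (fun p : Par m n × (Fin n ⊕ Fin m → ℝ) => p.1) (𝓝 (q, w)) (𝓝 q) := continuous_fst.tendsto _
    have h2 : Tendsto (fun p : Par m n × (Fin n ⊕ Fin m → ℝ) => p.2) (𝓝 (q, w)) (𝓝 w) := continuous_snd.tendsto _
    have hA1 : Tendsto (fun p : Par m n × (Fin n ⊕ Fin m → ℝ) => p.1.1) (𝓝 (q, w)) (𝓝 q.1) :=
      (continuous_fst.tendsto q).comp h1
    have hb1 : Tendsto (fun p : Par m n × (Fin n ⊕ Fin m → ℝ) => p.1.2.1) (𝓝 (q, w)) (𝓝 q.2.1) :=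
      ((continuous_fst.comp continuous_snd).tendsto q).comp h1
    have hx1 : Tendsto (fun p : Par m n × (Fin n ⊕ Fin m → ℝ) => (φ p.1).1) (𝓝 (q, w)) (𝓝 x) :=
      (continuous_fst.tendsto (x, y)).comp (hφ.comp h1)
    have hy1 : Tendsto (fun p : Par m n × (Fin n ⊕ Fin m → ℝ) => (φ p.1).2) (𝓝 (q, w)) (𝓝 y) :=
      (continuous_snd.tendsto (x, y)).comp (hφ.comp h1)
    have hs1 : Tendsto (fun p : Par m n × (Fin n ⊕ Fin m → ℝ) => sl p.1.1 p.1.2.1 (φ p.1).1) (𝓝 (q, w)) (𝓝 (sl q.1 q.2.1 x)) :=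
      tendsto_pi_nhds.2 fun i => tendsto_sl hA1 hb1 hx1 i
    exact tendsto_RR hA1 hs1 hy1 h2 (h.det_ne hA hμ)
  · filter_upwards [(continuous_fst.tendsto (q, w)).eventually hs] with p hp
    exact ⟨_, _, hp, rfl⟩

/-- continuity along a central path -/
lemma RR_cont {σ : Fin m → Bool} {A : Fin m → Fin n → ℝ} {b c} (hA : Inj A) {X : ℝ → Fin n → ℝ} {Y : ℝ → Fin m → ℝ}
    (hXY : ∀ μ, 0 < μ → SolS σ A b c μ (X μ) (Y μ)) (w) :
    ContinuousOn (fun μ => RR A (sl A b (X μ)) (Y μ) w) (Set.Ioi 0) := by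
  intro μ hμ
  have hμ : 0 < μ := hμ
  refine ContinuousAt.continuousWithinAt ?_
  obtain ⟨f, hf, hs⟩ := SolS.RR_persist (q := (A, b, c, μ)) (hXY μ hμ) hA hμ w
  have ht : Tendsto (fun t : ℝ => (((A, b, c, t) : Par m n), w)) (𝓝 μ) (𝓝 ((A, b, c, μ), w)) := by
    apply Continuous.tendsto' (by fun_prop); rfl
  refine (hf.comp ht).congr' ?_
  filter_upwards [ht.eventually hs, lt_mem_nhds hμ] with t ht' hμt
  obtain ⟨x', y', h1, h2⟩ := ht'
  obtain ⟨e1, e2⟩ := (hXY t hμt).uniq h1 hA hμt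
  simp only [Function.comp, h2]
  rw [e1, e2]

lemma exists_good_w {κ : Type*} [Finite κ] (A : Fin m → Fin n → ℝ) (s y : κ → Fin m → ℝ)
    (hm : 0 < m) (hdet : ∀ k, (MM A (s k) (y k)).det ≠ 0) : Dense {w | ∀ k, NN A (s k) (y k) w ≠ 0} := by
  have : {w | ∀ k, NN A (s k) (y k) w ≠ 0} = ⋂ k, {w | NN A (s k) (y k) w ≠ 0} := by ext; simp
  rw [this]
  have : Countable κ := Finite.to_countable
  refine dense_iInter_of_isOpen (fun k => ?_) fun k => ?_
  · refine isOpen_ne_fun ?_ continuous_const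
    exact continuous_NN.comp (by fun_prop : Continuous fun w => ((A, s k, y k), w))
  · set M := MM A (s k) (y k)
    set z := M⁻¹ *ᵥ eR with hz
    have hMz : M *ᵥ z = eR := by
      rw [hz, Matrix.mulVec_mulVec, Matrix.mul_nonsing_inv _ (isUnit_iff_ne_zero.2 (hdet k)), Matrix.one_mulVec]
    have hz0 : z ≠ 0 := by
      intro h0
      rw [h0, Matrix.mulVec_zero] at hMz
      have := congrFun hMz (Sum.inr ⟨0, hm⟩)
      simp [eR] at this
    have hne : z ⬝ᵥ z ≠ 0 := by rwa [Ne, dotProduct_self_eq_zero]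
    intro w
    rw [mem_closure_iff_nhds]
    intro t ht
    have hev : ∀ᶠ r in 𝓝[≠] (0:ℝ), w + r • z ∈ t := by
      refine nhdsWithin_le_nhds ?_
      have : Tendsto (fun r : ℝ => w + r • z) (𝓝 0) (𝓝 w) := by
        apply Continuous.tendsto' (by fun_prop); simp
      exact this ht
    have hev2 : ∀ᶠ r in 𝓝[≠] (0:ℝ), w ⬝ᵥ z + r * (z ⬝ᵥ z) ≠ 0 := by
      by_cases h0 : w ⬝ᵥ z = 0
      · filter_upwards [self_mem_nhdsWithin] with r hr
        rw [h0, zero_add]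
        exact mul_ne_zero hr hne
      · refine nhdsWithin_le_nhds ?_
        have : Tendsto (fun r : ℝ => w ⬝ᵥ z + r * (z ⬝ᵥ z)) (𝓝 0) (𝓝 (w ⬝ᵥ z)) := by
          apply Continuous.tendsto' (by fun_prop); simp
        exact this.eventually_ne h0
    obtain ⟨r, h1, h2⟩ := (hev.and hev2).exists
    refine ⟨_, h1, ?_⟩
    simp only [Set.mem_setOf_eq]
    rw [NN_eq _ _ _ _ z hMz]
    refine neg_ne_zero.2 (mul_ne_zero (hdet k) ?_)
    simpa [add_dotProduct] using h2

theorem sign_count (hn : 1 ≤ n) (hmn : n < m) (A : Fin m → Fin n → ℝ) (b : Fin m → ℝ) (c : Fin n → ℝ) (hA : Inj A)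
    (w : Fin n ⊕ Fin m → ℝ) {ι : Type*} [Fintype ι] (σ : ι → Fin m → Bool) (lo hi : ι → ℝ)
    (hlo : ∀ i, 0 < lo i) (hlh : ∀ i, lo i < hi i) (x0 x1 : ι → Fin n → ℝ) (y0 y1 : ι → Fin m → ℝ)
    (h0 : ∀ i, SolS (σ i) A b c (lo i) (x0 i) (y0 i)) (h1 : ∀ i, SolS (σ i) A b c (hi i) (x1 i) (y1 i))
    (hneg : ∀ i, RR A (sl A b (x0 i)) (y0 i) w * RR A (sl A b (x1 i)) (y1 i) w < 0)
    (hdisj : ∀ i j, i ≠ j → σ i = σ j → Disjoint (Set.Ioo (lo i) (hi i)) (Set.Ioo (lo j) (hi j))) :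
    Fintype.card ι ≤ 2 * (n * (m - 1).choose n) := by
  classical
  -- perturbation
  have hpert : ∀ i, ∀ᶠ p in 𝓝 ((A, b, c), w), ∃ x0' y0' x1' y1',
      SolS (σ i) p.1.1 p.1.2.1 p.1.2.2 (lo i) x0' y0' ∧ SolS (σ i) p.1.1 p.1.2.1 p.1.2.2 (hi i) x1' y1' ∧
      RR p.1.1 (sl p.1.1 p.1.2.1 x0') y0' p.2 * RR p.1.1 (sl p.1.1 p.1.2.1 x1') y1' p.2 < 0 := by
    intro i
    obtain ⟨f, hf, hfs⟩ := SolS.RR_persist (q := (A, b, c, lo i)) (h0 i) hA (hlo i) w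
    obtain ⟨g, hg, hgs⟩ := SolS.RR_persist (q := (A, b, c, hi i)) (h1 i) hA ((hlo i).trans (hlh i)) w
    have ht : ∀ r : ℝ, Tendsto (fun p : ((Fin m → Fin n → ℝ) × (Fin m → ℝ) × (Fin n → ℝ)) × (Fin n ⊕ Fin m → ℝ) =>
        (((p.1.1, p.1.2.1, p.1.2.2, r) : Par m n), p.2)) (𝓝 ((A, b, c), w)) (𝓝 ((A, b, c, r), w)) := by
      intro r
      apply Continuous.tendsto' (by fun_prop); rfl
    have hprod := (hf.comp (ht (lo i))).mul (hg.comp (ht (hi i)))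
    filter_upwards [hprod.eventually (gt_mem_nhds (hneg i)), (ht _).eventually hfs, (ht _).eventually hgs] with p hp hp1 hp2
    obtain ⟨x0', y0', e1, e2⟩ := hp1
    obtain ⟨x1', y1', e3, e4⟩ := hp2
    refine ⟨x0', y0', x1', y1', e1, e3, ?_⟩
    simp only [Function.comp, e2, e4] at hp
    exact hp
  obtain ⟨Q, hQ, hgen⟩ := gen_approx A b c
  have hall : ∀ᶠ p in 𝓝 (A, b, c), ∀ᶠ w' in 𝓝 w, ∀ i, ∃ x0' y0' x1' y1',
      SolS (σ i) p.1 p.2.1 p.2.2 (lo i) x0' y0' ∧ SolS (σ i) p.1 p.2.1 p.2.2 (hi i) x1' y1' ∧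
      RR p.1 (sl p.1 p.2.1 x0') y0' w' * RR p.1 (sl p.1 p.2.1 x1') y1' w' < 0 := by
    have := eventually_all.2 hpert
    rw [nhds_prod_eq] at this
    exact this.curry
  obtain ⟨k, hk⟩ := (hQ.eventually hall).exists
  have hG := hgen k
  generalize Q k = q at hk hG
  obtain ⟨A', b', c'⟩ := q
  simp only at hk hG
  have hA' : Inj A' := hG.inj hmn.le
  have hsol : ∀ (ω : Om A' b' c') (μ : ℝ), ∃ x y, 0 < μ → SolS ω.1 A' b' c' μ x y := by
    rintro ⟨τ, μ0, x, y, hμ0, hs⟩ μ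
    by_cases hμ : 0 < μ
    · obtain ⟨x', y', h'⟩ := exists_all hA' hs hμ0 μ hμ
      exact ⟨x', y', fun _ => h'⟩
    · exact ⟨0, 0, fun h => absurd h hμ⟩
  choose X Y hXY using hsol
  obtain ⟨w', hwne, hw'⟩ := (exists_good_w A' (fun ω : Om A' b' c' => sl A' b' (X ω 1)) (fun ω => Y ω 1) (by omega)
    fun ω => (hXY ω 1 one_pos).det_ne hA' one_pos).inter_nhds_nonempty hk
  have hzero : ∀ i, ∃ z : Om A' b' c' × ℝ, z.1.1 = σ i ∧ z.2 ∈ Set.Ioo (lo i) (hi i) ∧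
      NN A' (sl A' b' (X z.1 z.2)) (Y z.1 z.2) w' = 0 := by
    intro i
    obtain ⟨x0', y0', x1', y1', e1, e2, e3⟩ := hw' i
    let ω : Om A' b' c' := ⟨σ i, lo i, x0', y0', hlo i, e1⟩
    have hhi : 0 < hi i := (hlo i).trans (hlh i)
    have hsub : Set.Icc (lo i) (hi i) ⊆ Set.Ioi 0 := fun t ht => (hlo i).trans_le ht.1
    have hc := (RR_cont hA' (hXY ω) w').mono hsub
    obtain ⟨u1, u2⟩ := e1.uniq (hXY ω _ (hlo i)) hA' (hlo i)
    obtain ⟨u3, u4⟩ := e2.uniq (hXY ω _ hhi) hA' hhi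
    rw [u1, u2, u3, u4] at e3
    have hex : ∃ t ∈ Set.Ioo (lo i) (hi i), RR A' (sl A' b' (X ω t)) (Y ω t) w' = 0 := by
      rcases mul_neg_iff.1 e3 with ⟨p1, p2⟩ | ⟨p1, p2⟩
      · exact (intermediate_value_Ioo' (hlh i).le hc) ⟨p2, p1⟩
      · exact (intermediate_value_Ioo (hlh i).le hc) ⟨p1, p2⟩
    obtain ⟨t, ht, hr⟩ := hex
    refine ⟨(ω, t), rfl, ht, ?_⟩
    have htp : 0 < t := (hlo i).trans ht.1
    rw [RR, div_eq_zero_iff] at hr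
    exact hr.resolve_right ((hXY ω t htp).det_ne hA' htp)
  choose z hz1 hz2 hz3 using hzero
  have hinj : Function.Injective z := by
    intro i j hij
    by_contra hne
    refine Set.disjoint_left.1 (hdisj i j hne (by rw [← hz1, ← hz1, hij])) (hz2 i) ?_
    rw [hij]; exact hz2 j
  have := hG.count hn hmn hXY w' hwne (Finset.univ.image z) (by
    intro a ha
    obtain ⟨i, -, rfl⟩ := Finset.mem_image.1 ha
    exact ⟨(hlo i).trans (hz2 i).1, hz3 i⟩)
  rwa [Finset.card_image_of_injective _ hinj, Finset.card_univ] at this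

end CP

end

section

namespace CP

open ProbabilityTheory in
lemma ang : ∃ K : ENNReal, K * ENNReal.ofReal (2 * Real.pi) = 1 ∧ ∀ (T : Set ℝ) (S : Set (ℝ × ℝ)),
    MeasurableSet T → MeasurableSet S → T ⊆ Set.Ioo (-Real.pi) Real.pi →
    (∀ r φ, 0 < r → φ ∈ T → (r * Real.cos φ, r * Real.sin φ) ∈ S) →
    K * volume T ≤ ((gaussianReal 0 1).prod (gaussianReal 0 1)) S := by
  set h : ℝ → ENNReal := fun r => ENNReal.ofReal r * (gaussianPDF 0 1 r * gaussianPDF 0 1 0) with hh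
  have hmeas : Measurable h := by
    unfold h
    have := measurable_gaussianPDF 0 1
    fun_prop
  have hpdf : ∀ r φ, gaussianPDF 0 1 (r * Real.cos φ) * gaussianPDF 0 1 (r * Real.sin φ) =
      gaussianPDF 0 1 r * gaussianPDF 0 1 0 := by
    intro r φ
    simp only [gaussianPDF]
    rw [← ENNReal.ofReal_mul (gaussianPDFReal_nonneg _ _ _), ← ENNReal.ofReal_mul (gaussianPDFReal_nonneg _ _ _)]
    congr 1
    simp only [gaussianPDFReal]
    have : ∀ a b c d : ℝ, a + b = c + d → ∀ k : ℝ, (k * Real.exp a) * (k * Real.exp b) = (k * Real.exp c) * (k * Real.exp d) := by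
      intro a b c d he k
      have : Real.exp a * Real.exp b = Real.exp c * Real.exp d := by rw [← Real.exp_add, ← Real.exp_add, he]
      linear_combination k * k * this
    apply this
    have := Real.sin_sq_add_cos_sq φ
    simp
    linear_combination (- r^2/2) * this
  have hform : ∀ S : Set (ℝ × ℝ), MeasurableSet S → ((gaussianReal 0 1).prod (gaussianReal 0 1)) S =
      ∫⁻ p in Set.Ioi (0:ℝ) ×ˢ Set.Ioo (-Real.pi) Real.pi, S.indicator 1 (p.1 * Real.cos p.2, p.1 * Real.sin p.2) * h p.1 := by
    intro S hS
    rw [gaussianReal_of_var_ne_zero 0 one_ne_zero, prod_withDensity (measurable_gaussianPDF 0 1) (measurable_gaussianPDF 0 1),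
      withDensity_apply _ hS, ← lintegral_indicator hS]
    change ∫⁻ p : ℝ × ℝ, _ = _
    rw [← lintegral_comp_polarCoord_symm]
    refine lintegral_congr fun p => ?_
    simp only [polarCoord_symm_apply, h, smul_eq_mul]
    by_cases hp : (p.1 * Real.cos p.2, p.1 * Real.sin p.2) ∈ S
    · rw [Set.indicator_of_mem hp, Set.indicator_of_mem hp]
      simp [hpdf]
    · rw [Set.indicator_of_notMem hp, Set.indicator_of_notMem hp]
      simp
  refine ⟨∫⁻ r in Set.Ioi 0, h r, ?_, ?_⟩
  · have := hform Set.univ MeasurableSet.univ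
    simp only [measure_univ, Set.indicator_univ, Pi.one_apply, one_mul] at this
    rw [this, Measure.volume_eq_prod, ← Measure.prod_restrict, lintegral_prod _ (by fun_prop)]
    simp only [lintegral_const, Measure.restrict_apply_univ, Real.volume_Ioo]
    rw [lintegral_mul_const _ hmeas]
    congr 2
    ring
  · intro T S hT hS hTs hTS
    rw [hform S hS]
    calc _ = ∫⁻ p in Set.Ioi (0:ℝ) ×ˢ T, h p.1 := by
          rw [Measure.volume_eq_prod, ← Measure.prod_restrict, lintegral_prod _ (by fun_prop)]
          simp only [lintegral_const, Measure.restrict_apply_univ]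
          rw [lintegral_mul_const _ hmeas]
      _ = ∫⁻ p in Set.Ioi (0:ℝ) ×ˢ T, S.indicator 1 (p.1 * Real.cos p.2, p.1 * Real.sin p.2) * h p.1 := by
          refine setLIntegral_congr_fun (measurableSet_Ioi.prod hT) fun p hp => ?_
          simp [Set.indicator_of_mem (hTS p.1 p.2 hp.1 hp.2)]
      _ ≤ _ := lintegral_mono_set (Set.prod_mono_right hTs)

open ProbabilityTheory in
lemma marg {E : Type*} [NormedAddCommGroup E] [InnerProductSpace ℝ E] [FiniteDimensional ℝ E] [MeasurableSpace E] [BorelSpace E]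
    (e1 e2 : E) (h1 : ‖e1‖ = 1) (h2 : ‖e2‖ = 1) (h12 : inner ℝ e1 e2 = 0) :
    (stdGaussian E).map (fun v => (inner ℝ v e1, inner ℝ v e2)) = (gaussianReal 0 1).prod (gaussianReal 0 1) := by
  let L : E → EuclideanSpace ℝ (Fin 2) := fun v => !₂[inner ℝ v e1, inner ℝ v e2]
  have hL : Measurable L := by
    apply Continuous.measurable
    unfold L
    refine (PiLp.continuous_toLp 2 _).comp (continuous_pi fun i => ?_)
    fin_cases i <;> simp <;> fun_prop
  have hmap : (stdGaussian E).map L = stdGaussian (EuclideanSpace ℝ (Fin 2)) := by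
    have := Measure.isProbabilityMeasure_map (μ := stdGaussian E) hL.aemeasurable
    apply Measure.ext_of_charFun
    ext t
    rw [charFun_stdGaussian, charFun_apply, integral_map hL.aemeasurable (by fun_prop)]
    have : ∀ v, inner ℝ (L v) t = inner ℝ v (t 0 • e1 + t 1 • e2) := by
      intro v
      simp [L, PiLp.inner_apply, inner_add_right, inner_smul_right]
    simp_rw [this]
    rw [← charFun_apply, charFun_stdGaussian]
    congr 3
    have : ‖t 0 • e1 + t 1 • e2‖ ^ 2 = ‖t‖ ^ 2 := by
      rw [norm_add_sq_real, EuclideanSpace.real_norm_sq_eq]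
      simp [norm_smul, h1, h2, inner_smul_left, inner_smul_right, h12]
    exact_mod_cast this
  rw [← map_pi_eq_stdGaussian] at hmap
  have := (measurePreserving_finTwoArrow (gaussianReal 0 1)).map_eq
  rw [← this]
  have hc : (fun v => (inner ℝ v e1, inner ℝ v e2)) = (MeasurableEquiv.finTwoArrow ∘ (WithLp.ofLp (p := 2))) ∘ L := by
    funext v
    simp [L, MeasurableEquiv.finTwoArrow]
  have hm2 : Measurable (MeasurableEquiv.finTwoArrow (α := ℝ) ∘ (WithLp.ofLp (p := 2))) := by
    fun_prop
  rw [hc, ← Measure.map_map hm2 hL, hmap, Measure.map_map hm2 (by fun_prop)]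
  rfl

open ProbabilityTheory in
theorem crofton {E : Type*} [NormedAddCommGroup E] [InnerProductSpace ℝ E] [FiniteDimensional ℝ E] [MeasurableSpace E] [BorelSpace E]
    (a b : E) (ha : ‖a‖ = 1) (hb : ‖b‖ = 1) (hab : 0 ≤ inner ℝ a b) :
    ENNReal.ofReal ‖a - b‖ ≤ ENNReal.ofReal Real.pi * stdGaussian E {v | inner ℝ v a * inner ℝ v b < 0} := by
  by_cases hne : a = b
  · simp [hne]
  have hle : inner ℝ a b ≤ 1 := by
    have := real_inner_le_norm a b
    rwa [ha, hb, one_mul] at this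
  set k := inner ℝ a b with hk
  have hsq : ‖b - k • a‖ ^ 2 = 1 - k ^ 2 := by
    rw [norm_sub_sq_real, norm_smul, inner_smul_right, real_inner_comm, ← hk, ha, hb, Real.norm_eq_abs, mul_one, sq_abs]
    ring
  have hpos : 0 < ‖b - k • a‖ := by
    rw [norm_pos_iff]
    intro h0
    rw [h0] at hsq
    simp at hsq
    have : k = 1 := by nlinarith
    rw [this, one_smul, sub_eq_zero] at h0
    exact hne h0.symm
  set e2 : E := ‖b - k • a‖⁻¹ • (b - k • a) with he2
  have hn2 : ‖e2‖ = 1 := by rw [he2, norm_smul, norm_inv, norm_norm, inv_mul_cancel₀ hpos.ne']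
  have h12 : inner ℝ a e2 = 0 := by
    rw [he2, inner_smul_right, inner_sub_right, inner_smul_right, ← hk, real_inner_self_eq_norm_sq, ha]; simp
  set θ := Real.arccos k with hθ
  have hcos : Real.cos θ = k := Real.cos_arccos (by linarith) hle
  have hsin : Real.sin θ = ‖b - k • a‖ := by
    rw [hθ, Real.sin_arccos, ← hsq, Real.sqrt_sq (norm_nonneg _)]
  have hbe : b = Real.cos θ • a + Real.sin θ • e2 := by
    rw [hcos, hsin, he2, smul_smul, mul_inv_cancel₀ hpos.ne']; simp
  have hθ0 : 0 ≤ θ := Real.arccos_nonneg k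
  have hθ2 : θ ≤ Real.pi / 2 := Real.arccos_le_pi_div_two.2 hab
  have hpi := Real.pi_pos
  have hchord : ‖a - b‖ ≤ θ := by
    have h1 : ‖a - b‖ ^ 2 = 2 - 2 * Real.cos θ := by
      rw [norm_sub_sq_real, ← hk, ha, hb, hcos]; ring
    have h2 := Real.one_sub_sq_div_two_le_cos (x := θ)
    exact le_of_sq_le_sq (by nlinarith) hθ0
  obtain ⟨K, hK, hang⟩ := ang
  have hmS : MeasurableSet {p : ℝ × ℝ | p.1 * (Real.cos θ * p.1 + Real.sin θ * p.2) < 0} :=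
    measurableSet_lt (by fun_prop) (by fun_prop)
  have hev : stdGaussian E {v | inner ℝ v a * inner ℝ v b < 0} = ((gaussianReal 0 1).prod (gaussianReal 0 1))
      {p : ℝ × ℝ | p.1 * (Real.cos θ * p.1 + Real.sin θ * p.2) < 0} := by
    rw [← marg a e2 ha hn2 h12, Measure.map_apply (Continuous.measurable (by fun_prop)) hmS]
    congr 1
    ext v
    simp only [Set.mem_setOf_eq, Set.mem_preimage]
    conv_lhs => rw [hbe, inner_add_right, inner_smul_right, inner_smul_right]
  rw [hev]
  have := hang (Set.Ioo (Real.pi / 2) (Real.pi / 2 + θ) ∪ Set.Ioo (-(Real.pi / 2)) (-(Real.pi/2) + θ)) _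
    (measurableSet_Ioo.union measurableSet_Ioo) hmS ?_ ?_
  · have hvol : volume (Set.Ioo (Real.pi / 2) (Real.pi / 2 + θ) ∪ Set.Ioo (-(Real.pi / 2)) (-(Real.pi/2) + θ)) = ENNReal.ofReal (2 * θ) := by
      rw [measure_union _ measurableSet_Ioo]
      · rw [Real.volume_Ioo, Real.volume_Ioo, ← ENNReal.ofReal_add (by linarith) (by linarith)]
        congr 1; ring
      · rw [Set.disjoint_left]
        intro x hx hy
        have := hx.1
        have := hy.2
        linarith
    rw [hvol] at this
    calc ENNReal.ofReal ‖a - b‖ ≤ ENNReal.ofReal θ := ENNReal.ofReal_le_ofReal hchord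
      _ = (K * ENNReal.ofReal (2 * Real.pi)) * ENNReal.ofReal θ := by rw [hK, one_mul]
      _ = ENNReal.ofReal Real.pi * (K * ENNReal.ofReal (2 * θ)) := by
          rw [ENNReal.ofReal_mul (by norm_num), ENNReal.ofReal_mul (by norm_num)]; ring
      _ ≤ _ := by gcongr
  · rintro x (hx | hx)
    · exact ⟨by linarith [hx.1], by
        have := hx.2
        rcases hθ2.lt_or_eq with h | h
        · linarith
        · linarith⟩
    · exact ⟨by linarith [hx.1], by linarith [hx.2]⟩
  · intro r φ hr hφ
    have hform : r * Real.cos φ * (Real.cos θ * (r * Real.cos φ) + Real.sin θ * (r * Real.sin φ)) =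
        r ^ 2 * (Real.cos φ * Real.cos (φ - θ)) := by
      rw [Real.cos_sub]; ring
    simp only [Set.mem_setOf_eq]
    rw [hform]
    refine mul_neg_of_pos_of_neg (by positivity) ?_
    rcases hφ with h | h
    · exact mul_neg_of_neg_of_pos (Real.cos_neg_of_pi_div_two_lt_of_lt h.1 (by linarith [h.2]))
        (Real.cos_pos_of_mem_Ioo ⟨by linarith [h.1], by linarith [h.2]⟩)
    · refine mul_neg_of_pos_of_neg (Real.cos_pos_of_mem_Ioo ⟨by linarith [h.1], by linarith [h.2]⟩) ?_
      rw [← Real.cos_neg]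
      exact Real.cos_neg_of_pi_div_two_lt_of_lt (by linarith [h.2]) (by linarith [h.1])

end CP

end

section

namespace CP

lemma piece {E : Type*} [NormedAddCommGroup E] [NormedSpace ℝ E] {f g : ℝ → E} {p q ε : ℝ} (hpq : p ≤ q)
    (hf : ∀ t ∈ Set.Icc p q, HasDerivAt f (g t) t) (hg : ContinuousOn g (Set.Icc p q))
    (hε : ∀ t ∈ Set.Icc p q, ‖g t - g p‖ ≤ ε) :
    ∫ t in p..q, ‖g t‖ ≤ ‖f q - f p‖ + 2 * ε * (q - p) := by
  have h1 : ∫ t in p..q, ‖g t‖ ≤ ∫ t in p..q, (‖g p‖ + ε) := by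
    refine intervalIntegral.integral_mono_on hpq ?_ (by simp) ?_
    · refine ContinuousOn.intervalIntegrable ?_
      rw [Set.uIcc_of_le hpq]; exact hg.norm
    · intro t ht
      have := hε t ht
      have h2 := norm_le_norm_add_norm_sub' (g t) (g p)
      linarith
  have h2 : ‖(f q - q • g p) - (f p - p • g p)‖ ≤ ε * ‖q - p‖ := by
    refine Convex.norm_image_sub_le_of_norm_hasDerivWithin_le (f := fun t => f t - t • g p) (f' := fun t => g t - g p)
      (s := Set.Icc p q) ?_ hε (convex_Icc p q) (Set.left_mem_Icc.2 hpq) (Set.right_mem_Icc.2 hpq)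
    intro t ht
    have := (hf t ht).sub ((hasDerivAt_id t).smul_const (g p))
    rw [one_smul] at this
    exact this.hasDerivWithinAt
  have h3 : ‖(q - p) • g p‖ ≤ ‖f q - f p‖ + ε * (q - p) := by
    rw [Real.norm_of_nonneg (sub_nonneg.2 hpq)] at h2
    have : (q - p) • g p = (f q - f p) - ((f q - q • g p) - (f p - p • g p)) := by
      rw [sub_smul]; abel
    rw [this]
    exact (norm_sub_le _ _).trans (by linarith)
  rw [norm_smul, Real.norm_of_nonneg (sub_nonneg.2 hpq)] at h3
  rw [intervalIntegral.integral_const, smul_eq_mul] at h1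
  nlinarith

lemma polygon {E : Type*} [NormedAddCommGroup E] [NormedSpace ℝ E] {f g : ℝ → E} {a b ε : ℝ} (hab : a < b)
    (hf : ∀ t ∈ Set.Icc a b, HasDerivAt f (g t) t) (hg : ContinuousOn g (Set.Icc a b)) (hε : 0 < ε) :
    ∃ (N : ℕ) (t : ℕ → ℝ), StrictMono t ∧ (∀ i ≤ N, t i ∈ Set.Icc a b) ∧ (∀ i < N, ‖f (t (i+1)) - f (t i)‖ ≤ 1) ∧
      ∫ r in a..b, ‖g r‖ ≤ ∑ i ∈ Finset.range N, ‖f (t (i+1)) - f (t i)‖ + ε := by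
  have hba : 0 < b - a := sub_pos.2 hab
  set ε' := ε / (2 * (b - a)) with hε'
  have hε'0 : 0 < ε' := by positivity
  have u1 := Metric.uniformContinuousOn_iff_le.1 (isCompact_Icc.uniformContinuousOn_of_continuous hg) ε' hε'0
  have hfc : ContinuousOn f (Set.Icc a b) := fun t ht => (hf t ht).continuousAt.continuousWithinAt
  have u2 := Metric.uniformContinuousOn_iff_le.1 (isCompact_Icc.uniformContinuousOn_of_continuous hfc) 1 one_pos
  obtain ⟨d1, hd1, k1⟩ := u1
  obtain ⟨d2, hd2, k2⟩ := u2
  obtain ⟨N, hN⟩ := exists_nat_gt ((b - a) / min d1 d2)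
  have hd : 0 < min d1 d2 := lt_min hd1 hd2
  have hN0 : (0:ℝ) < N := lt_trans (by positivity) hN
  set h := (b - a) / N with hh
  have hh0 : 0 < h := by positivity
  have hhd : h ≤ min d1 d2 := by
    rw [hh, div_le_iff₀ hN0]
    rw [div_lt_iff₀ hd] at hN
    nlinarith
  have hNh : N * h = b - a := by rw [hh]; field_simp
  set t : ℕ → ℝ := fun i => a + i * h with ht
  have hstep : ∀ i, t (i+1) = t i + h := fun i => by simp only [ht]; push_cast; ring
  have htm : ∀ i ≤ N, t i ∈ Set.Icc a b := by
    intro i hi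
    have : (i:ℝ) ≤ N := by exact_mod_cast hi
    constructor
    · simp only [ht]; have : 0 ≤ (i:ℝ) * h := by positivity
      linarith
    · simp only [ht]
      nlinarith
  have hsub : ∀ i < N, Set.Icc (t i) (t (i+1)) ⊆ Set.Icc a b := fun i hi =>
    Set.Icc_subset_Icc (htm i hi.le).1 (htm (i+1) hi).2
  have hle : ∀ i, t i ≤ t (i+1) := fun i => by rw [hstep]; linarith
  refine ⟨N, t, strictMono_nat_of_lt_succ fun i => by rw [hstep]; linarith, htm, ?_, ?_⟩
  · intro i hi
    rw [← dist_eq_norm]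
    refine k2 _ (htm _ hi) _ (htm _ hi.le) ?_
    rw [hstep, dist_eq_norm, add_sub_cancel_left, Real.norm_of_nonneg hh0.le]
    exact hhd.trans (min_le_right _ _)
  · have h0 : t 0 = a := by simp [ht]
    have hNb : t N = b := by simp only [ht]; linarith
    rw [← h0, ← hNb, ← intervalIntegral.sum_integral_adjacent_intervals]
    · calc ∑ k ∈ Finset.range N, ∫ x in t k..t (k + 1), ‖g x‖
          ≤ ∑ k ∈ Finset.range N, (‖f (t (k+1)) - f (t k)‖ + 2 * ε' * h) := by
            refine Finset.sum_le_sum fun k hk => ?_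
            have hk := Finset.mem_range.1 hk
            have := piece (f := f) (g := g) (ε := ε') (hle k) (fun x hx => hf x (hsub k hk hx)) (hg.mono (hsub k hk)) ?_
            · rwa [hstep, add_sub_cancel_left, ← hstep] at this
            · intro x hx
              rw [← dist_eq_norm]
              refine k1 _ (hsub k hk hx) _ (htm _ hk.le) ?_
              rw [dist_eq_norm, Real.norm_of_nonneg (sub_nonneg.2 hx.1)]
              have := hx.2
              rw [hstep] at this
              have := hhd.trans (min_le_left _ _)
              linarith
        _ = _ := by
            rw [Finset.sum_add_distrib, Finset.sum_const, Finset.card_range, nsmul_eq_mul]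
            congr 1
            calc (N:ℝ) * (2 * ε' * h) = 2 * ε' * (N * h) := by ring
              _ = ε := by rw [hNh, hε']; field_simp
    · intro k hk
      refine ContinuousOn.intervalIntegrable ?_
      rw [Set.uIcc_of_le (hle k)]
      exact (hg.mono (hsub k hk)).norm

lemma exhaust {J : Set ℝ} (hJ : IsOpen J) (hJc : J.OrdConnected) {φ : ℝ → ℝ} (hφ : ContinuousOn φ J) (h0 : ∀ t, 0 ≤ φ t)
    {ε : ℝ} (hε : 0 < ε) :
    ∫ t in J, φ t ≤ ε ∨ ∃ a b, a < b ∧ Set.Icc a b ⊆ J ∧ ∫ t in J, φ t ≤ (∫ t in a..b, φ t) + ε := by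
  by_cases hint : IntegrableOn φ J
  swap
  · left; rw [integral_undef hint]; exact hε.le
  obtain ⟨F, hFc, hFs, hFu, hFm⟩ := hJ.exists_iUnion_isClosed
  set K : ℕ → Set ℝ := fun k => F k ∩ Set.Icc (-(k:ℝ)) k with hK
  have hKm : Monotone K := by
    intro i j hij
    have : (i:ℝ) ≤ j := by exact_mod_cast hij
    exact Set.inter_subset_inter (hFm hij) (Set.Icc_subset_Icc (by linarith) this)
  have hKc : ∀ k, IsCompact (K k) := fun k => isCompact_Icc.inter_left (hFc k)
  have hKu : ⋃ k, K k = J := by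
    apply subset_antisymm
    · exact Set.iUnion_subset fun k => Set.inter_subset_left.trans (hFs k)
    · intro x hx
      rw [← hFu] at hx
      obtain ⟨i, hi⟩ := Set.mem_iUnion.1 hx
      obtain ⟨j, hj⟩ := exists_nat_ge |x|
      refine Set.mem_iUnion.2 ⟨max i j, hFm (le_max_left i j) hi, abs_le.1 (hj.trans ?_)⟩
      exact_mod_cast le_max_right i j
  have ht := tendsto_setIntegral_of_monotone (f := φ) (μ := volume) (s := K) (fun k => (hKc k).measurableSet) hKm (by rwa [hKu])
  rw [hKu] at ht
  obtain ⟨k, hk⟩ := (ht.eventually (lt_mem_nhds (show (∫ t in J, φ t) - ε < ∫ t in J, φ t by linarith))).exists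
  rcases (K k).eq_empty_or_nonempty with he | hne
  · left
    rw [he] at hk; simp at hk; linarith
  · right
    have hKJ : K k ⊆ J := Set.inter_subset_left.trans (hFs k)
    have ha := hKJ ((hKc k).sInf_mem hne)
    have hb := hKJ ((hKc k).sSup_mem hne)
    set a := sInf (K k)
    set b := sSup (K k)
    obtain ⟨b', hbb', hb'⟩ : ∃ b', b < b' ∧ b' ∈ J := by
      have : ∀ᶠ x in 𝓝[>] b, x ∈ J := nhdsWithin_le_nhds (hJ.mem_nhds hb)
      obtain ⟨x, h1, h2⟩ := (this.and self_mem_nhdsWithin).exists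
      exact ⟨x, h2, h1⟩
    have hab : a ≤ b := Real.sInf_le_sSup _ (hKc k).bddBelow (hKc k).bddAbove
    have hsub : Set.Icc a b' ⊆ J := hJc.out ha hb'
    refine ⟨a, b', by linarith, hsub, ?_⟩
    have h1 : ∫ t in K k, φ t ≤ ∫ t in Set.Ioc a b', φ t := by
      rw [← integral_Icc_eq_integral_Ioc]
      refine setIntegral_mono_set (hint.mono_set hsub) (ae_of_all _ h0) (HasSubset.Subset.eventuallyLE ?_)
      intro x hx
      exact ⟨csInf_le (hKc k).bddBelow hx, (le_csSup (hKc k).bddAbove hx).trans hbb'.le⟩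
    rw [intervalIntegral.integral_of_le (by linarith)]
    linarith

/-- polygonal approximation of the length of a curve -/
lemma approx {E : Type*} [NormedAddCommGroup E] [NormedSpace ℝ E] {f : ℝ → E} {I : Set ℝ} (hI : I.OrdConnected)
    (hf : ∀ t ∈ interior I, ContDiffAt ℝ 1 f t) {ε : ℝ} (hε : 0 < ε) :
    ∃ (N : ℕ) (t : ℕ → ℝ), StrictMono t ∧ (∀ i < N, t i ∈ interior I ∧ t (i+1) ∈ interior I) ∧
      (∀ i < N, ‖f (t (i+1)) - f (t i)‖ ≤ 1) ∧
      ∫ r in I, ‖deriv f r‖ ≤ ∑ i ∈ Finset.range N, ‖f (t (i+1)) - f (t i)‖ + ε := by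
  have hae : interior I =ᵐ[volume] I := interior_ae_eq_of_null_frontier (hI.convex.addHaar_frontier volume)
  rw [← setIntegral_congr_set hae]
  have hg : ContinuousOn (deriv f) (interior I) :=
    ContDiffOn.continuousOn_deriv_of_isOpen (fun t ht => (hf t ht).contDiffWithinAt) isOpen_interior le_rfl
  have hoc : (interior I).OrdConnected := hI.interior
  rcases exhaust isOpen_interior hoc hg.norm (fun t => norm_nonneg _) (half_pos hε) with h | ⟨a, b, hab, hs, h⟩
  · refine ⟨0, fun i => i, Nat.strictMono_cast, by simp, by simp, ?_⟩
    simp; linarith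
  · obtain ⟨N, t, h1, h2, h3, h4⟩ := polygon (f := f) (g := deriv f) hab
      (fun t ht => ((hf t (hs ht)).differentiableAt one_ne_zero).hasDerivAt) (hg.mono hs) (half_pos hε)
    exact ⟨N, t, h1, fun i hi => ⟨hs (h2 i hi.le), hs (h2 (i+1) hi)⟩, h3, by linarith⟩

open ProbabilityTheory in
lemma crofton_sum {E : Type*} [NormedAddCommGroup E] [InnerProductSpace ℝ E] [FiniteDimensional ℝ E] [MeasurableSpace E] [BorelSpace E]
    {ι : Type*} [Fintype ι] (γ₀ γ₁ : ι → E) (h0 : ∀ i, ‖γ₀ i‖ = 1) (h1 : ∀ i, ‖γ₁ i‖ = 1) (h01 : ∀ i, ‖γ₁ i - γ₀ i‖ ≤ 1)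
    (M : ℕ) (hM : ∀ v : E, Nat.card {i // inner ℝ v (γ₀ i) * inner ℝ v (γ₁ i) < 0} ≤ M) :
    ∑ i, ‖γ₁ i - γ₀ i‖ ≤ Real.pi * M := by
  classical
  have hpos : ∀ i, 0 ≤ inner ℝ (γ₀ i) (γ₁ i) := by
    intro i
    have := norm_sub_sq_real (γ₁ i) (γ₀ i)
    rw [h0, h1, real_inner_comm] at this
    have h2 := h01 i
    have h3 := norm_nonneg (γ₁ i - γ₀ i)
    nlinarith
  rw [← ENNReal.ofReal_le_ofReal_iff (by positivity), ENNReal.ofReal_sum_of_nonneg (fun _ _ => norm_nonneg _)]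
  set S : ι → Set E := fun i => {v | inner ℝ v (γ₀ i) * inner ℝ v (γ₁ i) < 0} with hS
  have hSm : ∀ i, MeasurableSet (S i) := fun i =>
    measurableSet_lt (Continuous.measurable (by fun_prop)) measurable_const
  calc ∑ i, ENNReal.ofReal ‖γ₁ i - γ₀ i‖ ≤ ∑ i, ENNReal.ofReal Real.pi * stdGaussian E (S i) := by
        refine Finset.sum_le_sum fun i _ => ?_
        rw [norm_sub_rev]
        exact crofton _ _ (h0 i) (h1 i) (hpos i)
    _ = ENNReal.ofReal Real.pi * ∫⁻ v, ∑ i, (S i).indicator 1 v ∂(stdGaussian E) := by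
        rw [← Finset.mul_sum, lintegral_finsetSum _ (fun i _ => measurable_one.indicator (hSm i))]
        congr 1
        exact Finset.sum_congr rfl fun i _ => (lintegral_indicator_one (hSm i)).symm
    _ ≤ ENNReal.ofReal Real.pi * ∫⁻ v, M ∂(stdGaussian E) := by
        gcongr with v
        have : ∑ i, (S i).indicator (1 : E → ENNReal) v = ((Finset.univ.filter fun i => v ∈ S i).card : ENNReal) := by
          simp [Set.indicator_apply, Finset.sum_ite]
        rw [this]
        have h2 := hM v
        rw [Nat.card_eq_fintype_card, Fintype.card_subtype] at h2
        exact_mod_cast h2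
    _ = _ := by
        rw [lintegral_const, measure_univ, mul_one, ENNReal.ofReal_mul Real.pi_pos.le, ENNReal.ofReal_natCast]

end CP

end

section

namespace CP

variable {m n : ℕ}

abbrev ES (m n : ℕ) := EuclideanSpace ℝ (Fin n ⊕ (Fin m ⊕ Fin m))

def pr (A : Fin m → Fin n → ℝ) (v : ES m n) : Fin n ⊕ Fin m → ℝ :=
  Sum.elim (fun j => v (Sum.inl j) + ∑ i, A i j * v (Sum.inr (Sum.inl i))) (fun i => v (Sum.inr (Sum.inr i)))

def Eqs (A : Fin m → Fin n → ℝ) (b : Fin m → ℝ) (c : Fin n → ℝ) (σ : Fin m → Bool) (p : ES m n) (μ : ℝ) : Prop :=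
  (∀ i, (∑ j, A i j * p (Sum.inl j)) - p (Sum.inr (Sum.inl i)) = b i) ∧
  (∀ j, ∑ i, A i j * p (Sum.inr (Sum.inr i)) = c j) ∧
  (∀ i, p (Sum.inr (Sum.inl i)) * p (Sum.inr (Sum.inr i)) = μ) ∧
  (∀ i, (if σ i then (1:ℝ) else -1) * p (Sum.inr (Sum.inl i)) > 0)

lemma Eqs.sl_eq {A : Fin m → Fin n → ℝ} {b c σ p μ} (h : Eqs A b c σ p μ) :
    sl A b (fun j => p (Sum.inl j)) = fun i => p (Sum.inr (Sum.inl i)) := by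
  funext i
  have := h.1 i
  unfold sl
  linarith

lemma Eqs.sol {A : Fin m → Fin n → ℝ} {b c σ p μ} (h : Eqs A b c σ p μ) :
    SolS σ A b c μ (fun j => p (Sum.inl j)) (fun i => p (Sum.inr (Sum.inr i))) where
  dual := h.2.1
  comp i := by rw [h.sl_eq]; exact h.2.2.1 i
  sgn i := by rw [h.sl_eq]; exact h.2.2.2 i

/-- the linearized equations and the pairing with a covector -/
lemma pairing {A : Fin m → Fin n → ℝ} {b c σ} {p : ℝ → ES m n} {μ : ℝ} {p' : ES m n} (hp : HasDerivAt p p' μ)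
    (h : ∀ᶠ t in 𝓝 μ, Eqs A b c σ (p t) t) (hA : Inj A) (hμ : 0 < μ) (v : ES m n) :
    inner ℝ v p' = - RR A (sl A b (fun j => p μ (Sum.inl j))) (fun i => p μ (Sum.inr (Sum.inr i))) (pr A v) := by
  have hd : ∀ k, HasDerivAt (fun t => p t k) (p' k) μ := fun k =>
    ((EuclideanSpace.proj (𝕜 := ℝ) k).hasFDerivAt.comp_hasDerivAt μ hp)
  have h0 := h.self_of_nhds
  have d1 : ∀ i, p' (Sum.inr (Sum.inl i)) = ∑ j, A i j * p' (Sum.inl j) := by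
    intro i
    have e1 : HasDerivAt (fun t => (∑ j, A i j * p t (Sum.inl j)) - p t (Sum.inr (Sum.inl i)))
        ((∑ j, A i j * p' (Sum.inl j)) - p' (Sum.inr (Sum.inl i))) μ :=
      (HasDerivAt.fun_sum fun j _ => (hd (Sum.inl j)).const_mul (A i j)).fun_sub (hd _)
    have e2 := e1.congr_of_eventuallyEq (f₁ := fun _ => b i) (by filter_upwards [h] with t ht using (ht.1 i).symm)
    have := e2.unique (hasDerivAt_const μ (b i))
    linarith
  have d2 : ∀ j, ∑ i, A i j * p' (Sum.inr (Sum.inr i)) = 0 := by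
    intro j
    have e1 : HasDerivAt (fun t => ∑ i, A i j * p t (Sum.inr (Sum.inr i))) (∑ i, A i j * p' (Sum.inr (Sum.inr i))) μ :=
      (HasDerivAt.fun_sum fun i _ => (hd (Sum.inr (Sum.inr i))).const_mul (A i j))
    have e2 := e1.congr_of_eventuallyEq (f₁ := fun _ => c j) (by filter_upwards [h] with t ht using (ht.2.1 j).symm)
    exact e2.unique (hasDerivAt_const μ (c j))
  have d3 : ∀ i, p' (Sum.inr (Sum.inl i)) * p μ (Sum.inr (Sum.inr i)) + p μ (Sum.inr (Sum.inl i)) * p' (Sum.inr (Sum.inr i)) = 1 := by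
    intro i
    have e1 := (hd (Sum.inr (Sum.inl i))).mul (hd (Sum.inr (Sum.inr i)))
    have e2 := e1.congr_of_eventuallyEq (f₁ := fun t => t) (by filter_upwards [h] with t ht using (ht.2.2.1 i).symm)
    exact e2.unique (hasDerivAt_id μ)
  set z : Fin n ⊕ Fin m → ℝ := Sum.elim (fun j => p' (Sum.inl j)) (fun i => p' (Sum.inr (Sum.inr i))) with hz
  have hM : MM A (sl A b (fun j => p μ (Sum.inl j))) (fun i => p μ (Sum.inr (Sum.inr i))) *ᵥ z = eR := by
    funext k
    rcases k with j | i
    · simp only [MM, Matrix.mulVec, dotProduct, Fintype.sum_sum_type, Matrix.fromBlocks_apply₁₁, Matrix.of_apply,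
        Matrix.fromBlocks_apply₁₂, Matrix.zero_apply, zero_mul, Finset.sum_const_zero, zero_add, hz, Sum.elim_inr, eR, Sum.elim_inl]
      exact d2 j
    · simp only [MM, Matrix.mulVec, dotProduct, Fintype.sum_sum_type, Matrix.fromBlocks_apply₂₁, Matrix.of_apply,
        Matrix.fromBlocks_apply₂₂, Matrix.diagonal_apply, ite_mul, zero_mul, Finset.sum_ite_eq, Finset.mem_univ, if_true,
        hz, Sum.elim_inr, eR, Sum.elim_inl, h0.sl_eq]
      rw [← d3 i, d1 i, Finset.sum_mul]
      congr 1
      exact Finset.sum_congr rfl fun j _ => by ring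
  rw [RR, NN_eq _ _ _ _ z hM, neg_div, neg_neg, mul_div_cancel_left₀ _ (h0.sol.det_ne hA hμ)]
  simp only [PiLp.inner_apply, Fintype.sum_sum_type, dotProduct, hz, pr, Sum.elim_inl, Sum.elim_inr, d1]
  simp only [RCLike.inner_apply, conj_trivial, add_mul, Finset.sum_add_distrib]
  have : ∑ i, (∑ j, A i j * p' (Sum.inl j)) * v (Sum.inr (Sum.inl i)) =
      ∑ j, (∑ i, A i j * v (Sum.inr (Sum.inl i))) * p' (Sum.inl j) := by
    simp_rw [Finset.sum_mul]
    rw [Finset.sum_comm]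
    exact Finset.sum_congr rfl fun j _ => Finset.sum_congr rfl fun i _ => by ring
  rw [this, ← add_assoc]
  simp only [mul_comm]

lemma rank_inj (A : Matrix (Fin m) (Fin n) ℝ) (hA : A.rank = n) : Inj (fun i j => A i j) := by
  have hli : LinearIndependent ℝ A.col := by
    rw [linearIndependent_iff_card_eq_finrank_span, Fintype.card_fin, Set.finrank, ← Matrix.rank_eq_finrank_span_cols, hA]
  have := Matrix.mulVec_injective_iff.2 hli
  intro u hu
  apply this
  funext i
  simpa [Matrix.mulVec, dotProduct] using hu i

theorem main (hn : 1 ≤ n) (hmn : n < m) (A : Fin m → Fin n → ℝ) (hA : Inj A) (b : Fin m → ℝ) (c : Fin n → ℝ)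
    (I : (Fin m → Bool) → Set ℝ) (hIpos : ∀ σ, I σ ⊆ Set.Ioi 0) (hI : ∀ σ, (I σ).OrdConnected)
    (cp : (Fin m → Bool) → ℝ → ES m n) (hC2 : ∀ σ, ContDiffOn ℝ 2 (cp σ) (I σ))
    (heq : ∀ σ, ∀ μ ∈ I σ, Eqs A b c σ (cp σ μ) μ) (hne : ∀ σ, ∀ μ ∈ I σ, deriv (cp σ) μ ≠ 0) :
    ∑ σ, ∫ μ in I σ, ‖deriv (fun t => ‖deriv (cp σ) t‖⁻¹ • deriv (cp σ) t) μ‖ ≤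
      Real.pi * ((2 * (n * (m - 1).choose n) : ℕ) : ℝ) := by
  classical
  set γ : (Fin m → Bool) → ℝ → ES m n := fun σ t => ‖deriv (cp σ) t‖⁻¹ • deriv (cp σ) t with hγ
  have hat : ∀ σ, ∀ t ∈ interior (I σ), ContDiffAt ℝ 2 (cp σ) t := fun σ t ht =>
    (hC2 σ).contDiffAt (mem_interior_iff_mem_nhds.1 ht)
  have hγ1 : ∀ σ, ∀ t ∈ interior (I σ), ContDiffAt ℝ 1 (γ σ) t := by
    intro σ t ht
    have hd : ContDiffAt ℝ 1 (deriv (cp σ)) t := by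
      have h1 : ContDiffOn ℝ 1 (deriv (cp σ)) (interior (I σ)) :=
        ((hC2 σ).mono interior_subset).deriv_of_isOpen isOpen_interior (by norm_num)
      exact h1.contDiffAt (isOpen_interior.mem_nhds ht)
    have h0 := hne σ t (interior_subset ht)
    exact ((hd.norm ℝ h0).inv (norm_ne_zero_iff.2 h0)).smul hd
  refine le_of_forall_pos_le_add fun ε hε => ?_
  set k : ℝ := ((Fintype.card (Fin m → Bool) : ℕ) : ℝ) with hk
  have hk0 : 0 < k := by rw [hk]; exact_mod_cast Fintype.card_pos
  choose N t hmono hmem hclose hint using fun σ => approx (hI σ) (hγ1 σ) (div_pos hε hk0)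
  let ι := Σ σ : Fin m → Bool, Fin (N σ)
  have hunit : ∀ σ, ∀ r ∈ interior (I σ), ‖γ σ r‖ = 1 := fun σ r hr => by
    have := norm_ne_zero_iff.2 (hne σ r (interior_subset hr))
    simp only [hγ]
    rw [norm_smul, norm_inv, norm_norm, inv_mul_cancel₀ this]
  have hpair : ∀ σ, ∀ r ∈ interior (I σ), ∀ v : ES m n, inner ℝ v (γ σ r) =
      - (‖deriv (cp σ) r‖⁻¹ * RR A (sl A b (fun j => cp σ r (Sum.inl j))) (fun i => cp σ r (Sum.inr (Sum.inr i))) (pr A v)) := by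
    intro σ r hr v
    simp only [hγ]
    rw [inner_smul_right, pairing (p := cp σ) ((hat σ r hr).differentiableAt two_ne_zero).hasDerivAt
      (by filter_upwards [isOpen_interior.mem_nhds hr] with t ht using heq σ t (interior_subset ht)) hA
      (hIpos σ (interior_subset hr)) v]
    ring
  have key := crofton_sum (ι := ι) (fun i => γ i.1 (t i.1 i.2)) (fun i => γ i.1 (t i.1 (i.2 + 1)))
    (fun i => hunit _ _ (hmem i.1 i.2 i.2.2).1) (fun i => hunit _ _ (hmem i.1 i.2 i.2.2).2)
    (fun i => hclose i.1 i.2 i.2.2) (2 * (n * (m - 1).choose n)) ?_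
  · calc _ ≤ ∑ σ, (∑ i ∈ Finset.range (N σ), ‖γ σ (t σ (i+1)) - γ σ (t σ i)‖ + ε / k) :=
          Finset.sum_le_sum fun σ _ => hint σ
      _ = ∑ i : ι, ‖γ i.1 (t i.1 (i.2 + 1)) - γ i.1 (t i.1 i.2)‖ + ε := by
          rw [Finset.sum_add_distrib, Finset.sum_const, Finset.card_univ, nsmul_eq_mul, ← hk, mul_div_cancel₀ _ hk0.ne',
            Fintype.sum_sigma]
          congr 1
          refine Finset.sum_congr rfl fun σ _ => ?_
          rw [Finset.sum_range]
      _ ≤ _ := by gcongr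
  · intro v
    rw [Nat.card_eq_fintype_card]
    refine sign_count hn hmn A b c hA (pr A v) (fun i => i.1.1) (fun i => t i.1.1 i.1.2) (fun i => t i.1.1 (i.1.2 + 1))
      ?_ ?_ _ _ _ _ (fun i => (heq i.1.1 _ (interior_subset (hmem i.1.1 i.1.2 i.1.2.2).1)).sol)
      (fun i => (heq i.1.1 _ (interior_subset (hmem i.1.1 i.1.2 i.1.2.2).2)).sol) ?_ ?_
    · exact fun i => hIpos _ (interior_subset (hmem i.1.1 i.1.2 i.1.2.2).1)
    · exact fun i => hmono _ (Nat.lt_succ_self _)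
    · intro i
      have h := i.2
      rw [hpair _ _ (hmem i.1.1 i.1.2 i.1.2.2).1, hpair _ _ (hmem i.1.1 i.1.2 i.1.2.2).2] at h
      have p1 : 0 < ‖deriv (cp i.1.1) (t i.1.1 i.1.2)‖⁻¹ := inv_pos.2 (norm_pos_iff.2
        (hne _ _ (interior_subset (hmem i.1.1 i.1.2 i.1.2.2).1)))
      have p2 : 0 < ‖deriv (cp i.1.1) (t i.1.1 (i.1.2 + 1))‖⁻¹ := inv_pos.2 (norm_pos_iff.2
        (hne _ _ (interior_subset (hmem i.1.1 i.1.2 i.1.2.2).2)))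
      rw [neg_mul_neg, mul_mul_mul_comm] at h
      exact (pos_iff_neg_of_mul_neg h).1 (mul_pos p1 p2)
    · rintro ⟨⟨σ, i⟩, hi⟩ ⟨⟨σ', j⟩, hj⟩ hij hσ
      simp only at hσ
      subst hσ
      have hne' : (i:ℕ) ≠ j := by
        intro h
        apply hij
        have : i = j := Fin.ext h
        subst this
        rfl
      rw [Set.disjoint_left]
      rintro x ⟨h1, h2⟩ ⟨h3, h4⟩
      simp only at h1 h2 h3 h4
      rcases hne'.lt_or_gt with h | h
      · have := (hmono σ).monotone (Nat.succ_le_of_lt h)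
        simp only [Nat.succ_eq_add_one] at this
        linarith
      · have := (hmono σ).monotone (Nat.succ_le_of_lt h)
        simp only [Nat.succ_eq_add_one] at this
        linarith

end CP

end

end CPparts

/-- **Sum over sign conditions of the total curvature of the primal/dual central paths.**
The central path curve is encoded as a curve in `EuclideanSpace ℝ (Fin n ⊕ Fin m ⊕ Fin m)`,
whose three blocks are `x`, `s`, `y`. -/
theorem total_curvature_primal_dual_sum
    (m n : ℕ) (hn : 1 ≤ n) (hmn : n < m)
    (A : Matrix (Fin m) (Fin n) ℝ) (hA : A.rank = n)
    (b : Fin m → ℝ) (c : Fin n → ℝ) (hc : c ≠ 0)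
    (I : (Fin m → Bool) → Set ℝ)
    (hIpos : ∀ σ, I σ ⊆ Set.Ioi (0 : ℝ))
    (hIint : ∀ σ, (I σ).OrdConnected)
    (cp : (Fin m → Bool) → ℝ → EuclideanSpace ℝ (Fin n ⊕ (Fin m ⊕ Fin m)))
    (hC2 : ∀ σ, ContDiffOn ℝ 2 (cp σ) (I σ))
    (heq : ∀ σ, ∀ μ ∈ I σ,
      (∀ i : Fin m, (∑ j, A i j * cp σ μ (Sum.inl j)) - cp σ μ (Sum.inr (Sum.inl i)) = b i) ∧
      (∀ j : Fin n, (∑ i, A i j * cp σ μ (Sum.inr (Sum.inr i))) = c j) ∧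
      (∀ i : Fin m, cp σ μ (Sum.inr (Sum.inl i)) * cp σ μ (Sum.inr (Sum.inr i)) = μ) ∧
      (∀ i : Fin m, (if σ i then (1 : ℝ) else -1) * cp σ μ (Sum.inr (Sum.inl i)) > 0) ∧
      deriv (cp σ) μ ≠ 0) :
    ∑ σ : Fin m → Bool,
        ∫ μ in I σ, ‖deriv (fun t => ‖deriv (cp σ) t‖⁻¹ • deriv (cp σ) t) μ‖
      ≤ 2 * Real.pi * n * ((m - 1).choose n) := by
  have h := CP.main hn hmn (fun i j => A i j) (CP.rank_inj A hA) b c I hIpos hIint cp hC2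
    (fun σ μ hμ => ⟨(heq σ μ hμ).1, (heq σ μ hμ).2.1, (heq σ μ hμ).2.2.1, (heq σ μ hμ).2.2.2.1⟩)
    (fun σ μ hμ => (heq σ μ hμ).2.2.2.2)
  refine h.trans (le_of_eq ?_)
  push_cast
  ring
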